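/- Let r ≥ 3 and let F be a quasi-linear, inconsistent r-graph which admits all inconsistent descriptive sequences of order r. For every ε > 0, every locally (C(r,2)^(−C(r,2))+ε)-dense sequence of r-graphs has a member containing F as a subgraph. -/

import Mathlib

namespace UTD

/-- An `r`-uniform hypergraph on a finite vertex set of naturals. -/
structure RGraph (r : ℕ) where
  verts : Finset ℕ
  edges : Finset (Finset ℕ)
  edges_subset : ∀ e ∈ edges, e ⊆ verts
  edges_card : ∀ e ∈ edges, e.card = r

/-- `F` is a subgraph of `H`: an injection of `V(F)` into `V(H)` mapping edges to edges. -/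
def IsSubgraph {r : ℕ} (F H : RGraph r) : Prop :=
  ∃ φ : ℕ → ℕ, Set.InjOn φ ↑F.verts ∧ (∀ v ∈ F.verts, φ v ∈ H.verts) ∧
    ∀ e ∈ F.edges, e.image φ ∈ H.edges

/-- `H` is `(d, ε)`-dense: every `S ⊆ V(H)` with `|S| ≥ ε|V(H)|` spans at least
`(d - ε) * C(|S|, r)` edges. -/
def IsDense {r : ℕ} (H : RGraph r) (d ε : ℝ) : Prop :=
  ∀ S ⊆ H.verts, ε * H.verts.card ≤ S.card →
    (d - ε) * (S.card.choose r : ℝ) ≤ ((H.edges.filter (fun e => e ⊆ S)).card : ℝ)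

/-- A sequence of `r`-graphs is locally `d`-dense. -/
def LocallyDense {r : ℕ} (H : ℕ → RGraph r) (d : ℝ) : Prop :=
  ∃ ε : ℕ → ℝ, (∀ n, 0 < ε n) ∧
    Filter.Tendsto ε Filter.atTop (nhds 0) ∧
    Filter.Tendsto (fun n => (H n).verts.card) Filter.atTop Filter.atTop ∧
    ∀ n, IsDense (H n) d (ε n)

/-- The role (set of ranks, 1-indexed) that the elements of `p` play within the
set `e`, with respect to the order given by `ord`. -/
def role (ord : ℕ → ℕ) (e p : Finset ℕ) : Finset ℕ :=
  p.image (fun v => (e.filter (fun w => ord w < ord v)).card + 1)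

/-- Twin pair of edges: distinct edges intersecting in exactly two vertices. -/
def IsTwin {r : ℕ} (F : RGraph r) (e f : Finset ℕ) : Prop :=
  e ∈ F.edges ∧ f ∈ F.edges ∧ e ≠ f ∧ (e ∩ f).card = 2

/-- Quasi-linear: every edge `e` has a unique twin, and all other edges meet `e`
in at most one vertex. -/
def QuasiLinear {r : ℕ} (F : RGraph r) : Prop :=
  ∀ e ∈ F.edges, ∃ f ∈ F.edges, f ≠ e ∧ (e ∩ f).card = 2 ∧
    ∀ f' ∈ F.edges, f' ≠ e → f' ≠ f → (e ∩ f').card ≤ 1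

/-- `F` with the vertex order `ord` is consistently ordered. -/
def ConsistentlyOrdered {r : ℕ} (F : RGraph r) (ord : ℕ → ℕ) : Prop :=
  ∀ e f, IsTwin F e f → role ord e (e ∩ f) = role ord f (e ∩ f)

/-- `F` is consistent: some linear order of its vertices makes it consistently ordered. -/
def Consistent {r : ℕ} (F : RGraph r) : Prop :=
  ∃ ord : ℕ → ℕ, Set.InjOn ord ↑F.verts ∧ ConsistentlyOrdered F ord

/-- `p` is the head of the edge `e`: its two smallest vertices w.r.t. `ord`. -/
def IsHead (ord : ℕ → ℕ) (e p : Finset ℕ) : Prop :=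
  p ⊆ e ∧ p.card = 2 ∧ ∀ u ∈ p, ∀ w ∈ e, w ∉ p → ord u < ord w

/-- `p` is the tail of the edge `e`: its two largest vertices w.r.t. `ord`. -/
def IsTail (ord : ℕ → ℕ) (e p : Finset ℕ) : Prop :=
  p ⊆ e ∧ p.card = 2 ∧ ∀ u ∈ p, ∀ w ∈ e, w ∉ p → ord w < ord u

/-- Head-tail-mixing: for every linear order of the vertex set there are edges
`e, f` such that the head of `e` equals the tail of `f`. -/
def HeadTailMixing {r : ℕ} (F : RGraph r) : Prop :=
  ∀ ord : ℕ → ℕ, Set.InjOn ord ↑F.verts →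
    ∃ e ∈ F.edges, ∃ f ∈ F.edges, ∃ p : Finset ℕ, IsHead ord e p ∧ IsTail ord f p

inductive Letter : Type
  | X | Y | Z
  deriving DecidableEq

/-- A descriptive sequence of order `r`: `2r - 2` letters, among which `r - 2`
are `X`, `r - 2` are `Y`, and two are `Z`. -/
def IsDescSeq (r : ℕ) (σ : Fin (2 * r - 2) → Letter) : Prop :=
  (Finset.univ.filter (fun i => σ i = Letter.X)).card = r - 2 ∧
  (Finset.univ.filter (fun i => σ i = Letter.Y)).card = r - 2 ∧
  (Finset.univ.filter (fun i => σ i = Letter.Z)).card = 2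

/-- The descriptive sequence `XX…XZZYY…Y`. -/
def headTailSeq (r : ℕ) : Fin (2 * r - 2) → Letter := fun i =>
  if (i : ℕ) < r - 2 then Letter.X
  else if (i : ℕ) < r then Letter.Z
  else Letter.Y

/-- The role (set of ranks, 1-indexed) played by the positions of the two `Z`s
within the positions carrying letters different from `avoid`. -/
def seqRole (r : ℕ) (σ : Fin (2 * r - 2) → Letter) (avoid : Letter) : Finset ℕ :=
  (Finset.univ.filter (fun i => σ i = Letter.Z)).image
    (fun i => (Finset.univ.filter (fun j => σ j ≠ avoid ∧ j < i)).card + 1)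

/-- A descriptive sequence is consistent if its two `Z`s play the same role among
the `X/Z` positions as among the `Y/Z` positions. -/
def SeqConsistent (r : ℕ) (σ : Fin (2 * r - 2) → Letter) : Prop :=
  seqRole r σ Letter.Y = seqRole r σ Letter.X

def SeqInconsistent (r : ℕ) (σ : Fin (2 * r - 2) → Letter) : Prop :=
  IsDescSeq r σ ∧ ¬ SeqConsistent r σ

/-- The descriptive sequence `σ` describes the pair of edges `{e, f}` under the
vertex order `ord`. -/
def Describes (r : ℕ) (σ : Fin (2 * r - 2) → Letter) (ord : ℕ → ℕ)
    (e f : Finset ℕ) : Prop :=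
  ∃ w : Fin (2 * r - 2) → ℕ,
    (∀ i j : Fin (2 * r - 2), i < j → ord (w i) < ord (w j)) ∧
    (∀ v : ℕ, v ∈ e ∪ f ↔ ∃ i, w i = v) ∧
    (((∀ i, w i ∈ e ↔ σ i ≠ Letter.Y) ∧ (∀ i, w i ∈ f ↔ σ i ≠ Letter.X)) ∨
     ((∀ i, w i ∈ e ↔ σ i ≠ Letter.X) ∧ (∀ i, w i ∈ f ↔ σ i ≠ Letter.Y)))

/-- A quasi-linear `r`-graph admits the descriptive sequence `σ`: there is a
linear order of its vertices in which every twin pair of edges is described by `σ`. -/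
def AdmitsSeq {r : ℕ} (F : RGraph r) (σ : Fin (2 * r - 2) → Letter) : Prop :=
  ∃ ord : ℕ → ℕ, Set.InjOn ord ↑F.verts ∧
    ∀ e f, IsTwin F e f → Describes r σ ord e f

/-- Linear hypergraph: any two distinct edges intersect in at most one vertex. -/
def LinearGraph {r : ℕ} (H : RGraph r) : Prop :=
  ∀ e ∈ H.edges, ∀ f ∈ H.edges, e ≠ f → (e ∩ f).card ≤ 1

/-- Nowhere-empty sequence of `r`-graphs. -/
def NowhereEmpty {r : ℕ} (H : ℕ → RGraph r) : Prop :=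
  ∀ c : ℝ, 0 < c → ∃ n₀ : ℕ, ∀ n ≥ n₀, ∀ S : Fin r → Finset ℕ,
    (∀ i, S i ⊆ (H n).verts) →
    (∀ i j, i ≠ j → Disjoint (S i) (S j)) →
    (∀ i, c * (H n).verts.card ≤ (S i).card) →
    ∃ e ∈ (H n).edges, ∀ i, (e ∩ S i).Nonempty

/-- A `(k, r)`-reduced hypergraph. -/
structure ReducedGraph (k r : ℕ) where
  part : Fin k → Fin k → Finset ℕ
  part_symm : ∀ i j, part i j = part j i
  part_disj : ∀ i j i' j' : Fin k, i < j → i' < j' → (i, j) ≠ (i', j') →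
    Disjoint (part i j) (part i' j')
  edges : Finset (Finset ℕ)
  edges_card : ∀ e ∈ edges, e.card = r.choose 2
  edges_struct : ∀ e ∈ edges, ∃ t : Fin r → Fin k, StrictMono t ∧
    ∀ a b : Fin r, a < b → (e ∩ part (t a) (t b)).card = 1

/-- The constituent `A_{t 0, …, t (r-1)}` of a reduced hypergraph. -/
def constituent {k r : ℕ} (H : ReducedGraph k r) (t : Fin r → Fin k) :
    Finset (Finset ℕ) :=
  H.edges.filter (fun e => ∀ a b : Fin r, a < b → (e ∩ H.part (t a) (t b)).card = 1)

/-- A reduced hypergraph has density at least `d`. -/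
def HasDensity {k r : ℕ} (H : ReducedGraph k r) (d : ℝ) : Prop :=
  ∀ t : Fin r → Fin k, StrictMono t →
    d * ∏ p ∈ Finset.univ.filter (fun p : Fin r × Fin r => p.1 < p.2),
      ((H.part (t p.1) (t p.2)).card : ℝ) ≤ ((constituent H t).card : ℝ)

/-- The `(2r-2)`-tuple of indices `t` admits the descriptive sequence `σ` in the
reduced hypergraph `H`. -/
def TupleAdmits {k r : ℕ} (H : ReducedGraph k r) (σ : Fin (2 * r - 2) → Letter)
    (t : Fin (2 * r - 2) → Fin k) : Prop :=
  ∃ tx ty : Fin r → Fin k, StrictMono tx ∧ StrictMono ty ∧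
    Set.range tx = t '' {i | σ i ≠ Letter.Y} ∧
    Set.range ty = t '' {i | σ i ≠ Letter.X} ∧
    ∃ eX ∈ constituent H tx, ∃ eY ∈ constituent H ty, (eX ∩ eY).card = 1

/-- The uniform Turán density threshold `C(r,2)^(-C(r,2))`. -/
noncomputable def piR (r : ℕ) : ℝ := ((r.choose 2 : ℝ) ^ (r.choose 2))⁻¹


section Box
variable {ι : Type*} [Fintype ι] [DecidableEq ι]

/-- Average of `f` over the box `∏ U i`. -/
noncomputable def EU (U : ι → Finset ℕ) (f : (ι → ℕ) → ℝ) : ℝ :=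
  (∑ x ∈ Fintype.piFinset U, f x) / ((Fintype.piFinset U).card : ℝ)

/-- Conditional average of `g` given the coordinates in `P`. -/
noncomputable def cnd (U : ι → Finset ℕ) (g : (ι → ℕ) → ℝ) (P : Finset ι) (x : ι → ℕ) : ℝ :=
  EU U (fun y => g (P.piecewise x y))

/-- `f` depends only on the coordinates in `P`. -/
def Dep (f : (ι → ℕ) → ℝ) (P : Finset ι) : Prop :=
  ∀ x y : ι → ℕ, (∀ i ∈ P, x i = y i) → f x = f y

lemma Dep.mono {f : (ι → ℕ) → ℝ} {P Q : Finset ι} (h : Dep f P) (hPQ : P ⊆ Q) : Dep f Q :=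
  fun x y hxy => h x y fun i hi => hxy i (hPQ hi)

lemma Dep.mul {f g : (ι → ℕ) → ℝ} {P : Finset ι} (h : Dep f P) (h' : Dep g P) :
    Dep (fun x => f x * g x) P :=
  fun x y hxy => by simp only [h x y hxy, h' x y hxy]

lemma Dep.cnd (U : ι → Finset ℕ) (g : (ι → ℕ) → ℝ) (P : Finset ι) : Dep (cnd U g P) P := by
  intro x y hxy
  unfold UTD.cnd
  congr 1; ext z; congr 1; ext i
  by_cases hi : i ∈ P <;> simp [hi, hxy]

lemma pi_card_pos {U : ι → Finset ℕ} (hU : ∀ i, (U i).Nonempty) :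
    (0 : ℝ) < ((Fintype.piFinset U).card : ℝ) := by
  exact_mod_cast Finset.card_pos.2 (Fintype.piFinset_nonempty.2 hU)

lemma EU_mul_card {U : ι → Finset ℕ} (hU : ∀ i, (U i).Nonempty) (f : (ι → ℕ) → ℝ) :
    EU U f * ((Fintype.piFinset U).card : ℝ) = ∑ x ∈ Fintype.piFinset U, f x := by
  unfold EU; field_simp [(pi_card_pos hU).ne']

lemma EU_const {U : ι → Finset ℕ} (hU : ∀ i, (U i).Nonempty) (c : ℝ) :
    EU U (fun _ => c) = c := by
  have := pi_card_pos hU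
  unfold EU; simp only [Finset.sum_const, nsmul_eq_mul]; field_simp

lemma EU_add (U : ι → Finset ℕ) (f g : (ι → ℕ) → ℝ) :
    EU U (fun x => f x + g x) = EU U f + EU U g := by
  unfold EU; rw [Finset.sum_add_distrib, add_div]

lemma EU_sub (U : ι → Finset ℕ) (f g : (ι → ℕ) → ℝ) :
    EU U (fun x => f x - g x) = EU U f - EU U g := by
  unfold EU; rw [Finset.sum_sub_distrib, sub_div]

lemma EU_cmul (U : ι → Finset ℕ) (c : ℝ) (f : (ι → ℕ) → ℝ) :
    EU U (fun x => c * f x) = c * EU U f := by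
  unfold EU; rw [← Finset.mul_sum, mul_div_assoc]

lemma EU_sum {κ : Type*} (U : ι → Finset ℕ) (s : Finset κ) (f : κ → (ι → ℕ) → ℝ) :
    EU U (fun x => ∑ k ∈ s, f k x) = ∑ k ∈ s, EU U (f k) := by
  unfold EU; rw [Finset.sum_comm, Finset.sum_div]

lemma EU_mono {U : ι → Finset ℕ} {f g : (ι → ℕ) → ℝ}
    (h : ∀ x ∈ Fintype.piFinset U, f x ≤ g x) : EU U f ≤ EU U g := by
  unfold EU; gcongr with x hx; exact h x hx

lemma EU_congr {U : ι → Finset ℕ} {f g : (ι → ℕ) → ℝ}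
    (h : ∀ x ∈ Fintype.piFinset U, f x = g x) : EU U f = EU U g := by
  unfold EU; rw [Finset.sum_congr rfl h]

lemma EU_nonneg {U : ι → Finset ℕ} {f : (ι → ℕ) → ℝ}
    (h : ∀ x, 0 ≤ f x) : 0 ≤ EU U f := by
  unfold EU; exact div_nonneg (Finset.sum_nonneg fun x _ => h x) (by positivity)

lemma EU_le_one {U : ι → Finset ℕ} (hU : ∀ i, (U i).Nonempty) {f : (ι → ℕ) → ℝ}
    (h : ∀ x, f x ≤ 1) : EU U f ≤ 1 := by
  rw [← EU_const hU 1]; exact EU_mono fun x _ => h x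

lemma EU_abs_le {U : ι → Finset ℕ} (hU : ∀ i, (U i).Nonempty) {f : (ι → ℕ) → ℝ} {c : ℝ}
    (h : ∀ x, |f x| ≤ c) : |EU U f| ≤ c := by
  rw [abs_le]
  constructor
  · rw [← EU_const hU (-c)]; exact EU_mono fun x _ => (abs_le.1 (h x)).1
  · conv_rhs => rw [← EU_const hU c]
    exact EU_mono fun x _ => (abs_le.1 (h x)).2

/-- The mixing identity. -/
lemma EU_mix {U : ι → Finset ℕ} (hU : ∀ i, (U i).Nonempty) (C : Finset ι) (f : (ι → ℕ) → ℝ) :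
    EU U (fun z => EU U (fun x => f (C.piecewise x z))) = EU U f := by
  have hc := pi_card_pos hU
  have key : ∑ z ∈ Fintype.piFinset U, ∑ x ∈ Fintype.piFinset U, f (C.piecewise x z)
      = ∑ z ∈ Fintype.piFinset U, ∑ x ∈ Fintype.piFinset U, f x := by
    rw [← Finset.sum_product', ← Finset.sum_product']
    refine Finset.sum_bij' (fun p _ => (C.piecewise p.1 p.2, C.piecewise p.2 p.1))
      (fun p _ => (C.piecewise p.1 p.2, C.piecewise p.2 p.1)) ?_ ?_ ?_ ?_ ?_
    · rintro ⟨z, x⟩ h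
      simp only [Finset.mem_product, Fintype.mem_piFinset] at h ⊢
      constructor <;> intro i <;> by_cases hi : i ∈ C <;> simp [hi, h.1 i, h.2 i]
    · rintro ⟨z, x⟩ h
      simp only [Finset.mem_product, Fintype.mem_piFinset] at h ⊢
      constructor <;> intro i <;> by_cases hi : i ∈ C <;> simp [hi, h.1 i, h.2 i]
    · rintro ⟨z, x⟩ h
      ext i <;> by_cases hi : i ∈ C <;> simp [hi]
    · rintro ⟨z, x⟩ h
      ext i <;> by_cases hi : i ∈ C <;> simp [hi]
    · rintro ⟨z, x⟩ h
      rfl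
  unfold EU
  rw [← Finset.sum_div, key]
  simp only [Finset.sum_const, nsmul_eq_mul]
  field_simp

lemma EU_proj {U : ι → Finset ℕ} (hU : ∀ i, (U i).Nonempty) {g s : (ι → ℕ) → ℝ}
    {e f P : Finset ι} (hg : Dep g e) (hs : Dep s f) (hP : e ∩ f = P) :
    EU U (fun x => g x * s x) = EU U (fun x => cnd U g P x * s x) := by
  have h1 : EU U (fun x => g x * s x)
      = EU U (fun z => EU U (fun x => g (P.piecewise x z) * s x)) := by
    rw [← EU_mix hU f]
    congr 1; ext z; congr 1; ext x
    congr 1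
    · apply hg
      intro i hi
      by_cases hf : i ∈ f
      · have : i ∈ P := by rw [← hP]; simp [hi, hf]
        simp [hf, this]
      · have : i ∉ P := by rw [← hP]; simp [hf]
        simp [hf, this]
    · apply hs
      intro i hi
      simp [hi]
  rw [h1]
  unfold cnd
  have h2 : ∀ x, EU U (fun y => g (P.piecewise x y)) * s x
      = EU U (fun y => g (P.piecewise x y) * s x) := by
    intro x
    rw [mul_comm, ← EU_cmul]
    congr 1; ext y; ring
  simp only [h2]
  unfold EU
  rw [← Finset.sum_div, ← Finset.sum_div, Finset.sum_comm]

lemma cnd_empty (U : ι → Finset ℕ) (g : (ι → ℕ) → ℝ) (x : ι → ℕ) :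
    cnd U g ∅ x = EU U g := by
  unfold cnd; simp

lemma cnd_nonneg {U : ι → Finset ℕ} {g : (ι → ℕ) → ℝ} (h : ∀ x, 0 ≤ g x)
    (P : Finset ι) (x : ι → ℕ) : 0 ≤ cnd U g P x := EU_nonneg fun _ => h _

lemma cnd_le_one {U : ι → Finset ℕ} (hU : ∀ i, (U i).Nonempty) {g : (ι → ℕ) → ℝ}
    (h : ∀ x, g x ≤ 1) (P : Finset ι) (x : ι → ℕ) : cnd U g P x ≤ 1 :=
  EU_le_one hU fun _ => h _

/-- energy -/
noncomputable def Q (U : ι → Finset ℕ) (g : (ι → ℕ) → ℝ) (P : Finset ι) : ℝ :=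
  EU U (fun x => cnd U g P x ^ 2)

lemma proj_sum (U : ι → Finset ℕ) {g s : (ι → ℕ) → ℝ} {P : Finset ι}
    (hs : Dep s P) :
    ∑ x ∈ Fintype.piFinset U, g x * s x = ∑ x ∈ Fintype.piFinset U, cnd U g P x * s x := by
  by_cases hU : ∀ i, (U i).Nonempty
  · have hg : Dep g Finset.univ := fun x y h => by rw [show x = y from funext fun i => h i (by simp)]
    have := EU_proj hU hg hs (Finset.univ_inter P)
    rw [← EU_mul_card hU, ← EU_mul_card hU, this]
  · have : Fintype.piFinset U = ∅ := by
      rw [← Finset.not_nonempty_iff_eq_empty, Fintype.piFinset_nonempty]; exact hU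
    simp [this]

lemma card_mul_Q (U : ι → Finset ℕ) (g : (ι → ℕ) → ℝ) (P : Finset ι) :
    ((Fintype.piFinset U).card : ℝ) * Q U g P = ∑ x ∈ Fintype.piFinset U, cnd U g P x ^ 2 := by
  by_cases hU : ∀ i, (U i).Nonempty
  · unfold Q; rw [mul_comm, EU_mul_card hU]
  · have : Fintype.piFinset U = ∅ := by
      rw [← Finset.not_nonempty_iff_eq_empty, Fintype.piFinset_nonempty]; exact hU
    simp [this]

/-- variational bound for the energy -/
lemma var_le (U : ι → Finset ℕ) {g s : (ι → ℕ) → ℝ} {P : Finset ι} (hs : Dep s P) :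
    ∑ x ∈ Fintype.piFinset U, (2 * s x * g x - s x ^ 2)
      ≤ ((Fintype.piFinset U).card : ℝ) * Q U g P := by
  rw [card_mul_Q]
  have h1 : ∑ x ∈ Fintype.piFinset U, (2 * s x * g x - s x ^ 2)
      = ∑ x ∈ Fintype.piFinset U, (2 * s x * cnd U g P x - s x ^ 2) := by
    have := proj_sum U (g := g) hs
    rw [Finset.sum_sub_distrib, Finset.sum_sub_distrib]
    congr 1
    have e1 : ∀ h : (ι → ℕ) → ℝ, ∑ x ∈ Fintype.piFinset U, 2 * s x * h x
        = 2 * ∑ x ∈ Fintype.piFinset U, h x * s x := by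
      intro h; rw [Finset.mul_sum]; exact Finset.sum_congr rfl fun x _ => by ring
    rw [e1, e1, this]
  rw [h1]
  apply Finset.sum_le_sum
  intro x _
  nlinarith [sq_nonneg (s x - cnd U g P x)]

lemma var_eq (U : ι → Finset ℕ) (g : (ι → ℕ) → ℝ) (P : Finset ι) :
    ∑ x ∈ Fintype.piFinset U, (2 * cnd U g P x * g x - cnd U g P x ^ 2)
      = ((Fintype.piFinset U).card : ℝ) * Q U g P := by
  rw [card_mul_Q]
  have := proj_sum U (g := g) (Dep.cnd U g P)
  rw [Finset.sum_sub_distrib]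
  have e1 : ∑ x ∈ Fintype.piFinset U, 2 * cnd U g P x * g x
        = 2 * ∑ x ∈ Fintype.piFinset U, g x * cnd U g P x := by
    rw [Finset.mul_sum]; exact Finset.sum_congr rfl fun x _ => by ring
  rw [e1, this]
  have e2 : ∑ x ∈ Fintype.piFinset U, cnd U g P x * cnd U g P x
    = ∑ x ∈ Fintype.piFinset U, cnd U g P x ^ 2 := Finset.sum_congr rfl fun x _ => by ring
  rw [e2]; ring

end Box

section Box2
open Classical in
/-- indicator of the event that every coordinate lies in the prescribed set -/
noncomputable def ind {ι : Type*} (A : ι → Set ℕ) (x : ι → ℕ) : ℝ :=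
  if ∀ i, x i ∈ A i then 1 else 0

variable {ι : Type*} [Fintype ι] [DecidableEq ι]

open Classical in
/-- the sub-box of `U` indexed by `S` in the partition induced by `A` -/
noncomputable def sb (U : ι → Finset ℕ) (A : ι → Set ℕ) (S : Finset ι) : ι → Finset ℕ :=
  fun i => if i ∈ S then (U i).filter (fun a => a ∈ A i) else (U i).filter (fun a => a ∉ A i)

lemma sb_subset (U : ι → Finset ℕ) (A : ι → Set ℕ) (S : Finset ι) (i : ι) :
    sb U A S i ⊆ U i := by
  unfold sb; classical split_ifs <;> apply Finset.filter_subset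

lemma split_sum (U : ι → Finset ℕ) (A : ι → Set ℕ) (f : (ι → ℕ) → ℝ) :
    ∑ x ∈ Fintype.piFinset U, f x
      = ∑ S : Finset ι, ∑ x ∈ Fintype.piFinset (sb U A S), f x := by
  classical
  rw [← Finset.sum_fiberwise (Fintype.piFinset U)
    (fun x => (Finset.univ.filter (fun i => x i ∈ A i) : Finset ι)) f]
  refine Finset.sum_congr rfl fun S _ => Finset.sum_congr ?_ fun _ _ => rfl
  ext x
  simp only [Finset.mem_filter, Fintype.mem_piFinset, sb]
  constructor
  · rintro ⟨h1, h2⟩ i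
    subst h2
    by_cases hi : x i ∈ A i <;> simp [hi, h1 i]
  · intro h
    constructor
    · intro i
      have := h i
      split_ifs at this <;> simp at this <;> exact this.1
    · ext i
      have := h i
      by_cases hi : i ∈ S
      · simp [hi] at this; simp [hi, this]
      · simp [hi] at this; simp [hi, this]

lemma mem_sb_univ (U : ι → Finset ℕ) (A : ι → Set ℕ) (f : (ι → ℕ) → ℝ) :
    ∑ x ∈ Fintype.piFinset (sb U A Finset.univ), f x
      = ∑ x ∈ Fintype.piFinset U, f x * ind A x := by
  classical
  unfold ind
  simp only [mul_ite, mul_one, mul_zero]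
  rw [← Finset.sum_filter]
  refine Finset.sum_congr ?_ fun _ _ => rfl
  ext x
  simp [sb, forall_and]

lemma gain (U : ι → Finset ℕ) (A : ι → Set ℕ) (g s : (ι → ℕ) → ℝ) (P : Finset ι)
    (hs1 : ∀ x, |s x| ≤ 1) (hs : Dep s P) (θ : ℝ) :
    ((Fintype.piFinset U).card : ℝ) * Q U g P
      + 2 * θ * (∑ x ∈ Fintype.piFinset U, (g x - cnd U g P x) * (s x * ind A x))
      - θ ^ 2 * ((Fintype.piFinset U).card : ℝ)
    ≤ ∑ S : Finset ι, ((Fintype.piFinset (sb U A S)).card : ℝ) * Q (sb U A S) g P := by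
  classical
  have h1 : ∀ S : Finset ι,
      ∑ x ∈ Fintype.piFinset (sb U A S), (2 * cnd U g P x * g x - cnd U g P x ^ 2)
      + (if S = Finset.univ then ∑ x ∈ Fintype.piFinset (sb U A S),
          (2 * θ * ((g x - cnd U g P x) * s x) - θ ^ 2) else 0)
      ≤ ((Fintype.piFinset (sb U A S)).card : ℝ) * Q (sb U A S) g P := by
    intro S
    split_ifs with hS
    · have hd : Dep (fun x => cnd U g P x + θ * s x) P := by
        intro x y hxy
        simp only [hs x y hxy, Dep.cnd U g P x y hxy]
      refine le_trans ?_ (var_le (sb U A S) hd)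
      rw [← Finset.sum_add_distrib]
      apply Finset.sum_le_sum
      intro x _
      have : s x ^ 2 ≤ 1 := by
        have := hs1 x
        rw [← sq_abs]; nlinarith [abs_nonneg (s x)]
      nlinarith [sq_nonneg θ, mul_le_mul_of_nonneg_left this (sq_nonneg θ)]
    · rw [add_zero]
      exact var_le (sb U A S) (Dep.cnd U g P)
  refine le_trans ?_ (Finset.sum_le_sum fun S _ => h1 S)
  rw [Finset.sum_add_distrib, ← split_sum, var_eq]
  simp only [Finset.sum_ite_eq', Finset.mem_univ, if_true]
  rw [Finset.sum_sub_distrib, ← Finset.mul_sum, mem_sb_univ]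
  have e1 : ∑ x ∈ Fintype.piFinset U, (g x - cnd U g P x) * s x * ind A x
    = ∑ x ∈ Fintype.piFinset U, (g x - cnd U g P x) * (s x * ind A x) :=
    Finset.sum_congr rfl fun x _ => by ring
  rw [e1]
  have e2 : ∑ x ∈ Fintype.piFinset (sb U A Finset.univ), θ ^ 2
      ≤ θ ^ 2 * ((Fintype.piFinset U).card : ℝ) := by
    rw [Finset.sum_const, nsmul_eq_mul, mul_comm]
    gcongr
    exact Fintype.piFinset_subset _ _ (fun i => sb_subset U A _ i)
  linarith

/-- regularity of a box with respect to `g` conditioned on `P` -/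
def Reg (U : ι → Finset ℕ) (g : (ι → ℕ) → ℝ) (P : Finset ι) (ε : ℝ) : Prop :=
  ∀ s : (ι → ℕ) → ℝ, (∀ x, |s x| ≤ 1) → Dep s P → ∀ A : ι → Set ℕ,
    |EU U (fun x => (g x - cnd U g P x) * (s x * ind A x))| ≤ ε

lemma Q_nonneg (U : ι → Finset ℕ) (g : (ι → ℕ) → ℝ) (P : Finset ι) : 0 ≤ Q U g P :=
  EU_nonneg fun _ => sq_nonneg _

lemma Q_le_one {U : ι → Finset ℕ} (hU : ∀ i, (U i).Nonempty) {g : (ι → ℕ) → ℝ}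
    (h0 : ∀ x, 0 ≤ g x) (h1 : ∀ x, g x ≤ 1) (P : Finset ι) : Q U g P ≤ 1 :=
  EU_le_one hU fun x => pow_le_one₀ (cnd_nonneg h0 P x) (cnd_le_one hU h1 P x)

lemma exists_regular (κ : Type*) [Fintype κ] (ι : Type*) [Fintype ι] [DecidableEq ι]
    (ε : ℝ) (hε : 0 < ε) :
    ∃ c : ℝ, 0 < c ∧ c ≤ 1 ∧ ∀ (V : ι → Finset ℕ), (∀ i, (V i).Nonempty) →
      ∀ (g : κ → (ι → ℕ) → ℝ) (P : κ → Finset ι), (∀ k x, 0 ≤ g k x) → (∀ k x, g k x ≤ 1) →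
      ∃ U : ι → Finset ℕ, (∀ i, U i ⊆ V i) ∧ (∀ i, (U i).Nonempty) ∧
        (c * ((Fintype.piFinset V).card : ℝ) ≤ ((Fintype.piFinset U).card : ℝ)) ∧
        (∀ i, c * ((V i).card : ℝ) ≤ ((U i).card : ℝ)) ∧
        ∀ k, Reg U (g k) (P k) ε := by
  classical
  set n2 : ℝ := (Fintype.card (Finset ι) : ℝ) with hn2
  have hn2pos : 0 < n2 := by
    rw [hn2]; exact_mod_cast Fintype.card_pos
  set lam : ℝ := ε ^ 2 / (2 * n2) with hlam
  have hlampos : 0 < lam := by positivity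
  set M : ℝ := (Fintype.card κ : ℝ) with hM
  refine ⟨Real.exp (-(M / lam)), Real.exp_pos _, ?_, ?_⟩
  · rw [Real.exp_le_one_iff]
    have : 0 ≤ M := by rw [hM]; positivity
    have := div_nonneg this hlampos.le
    linarith
  intro V hV g P hg0 hg1
  set Φ : (ι → Finset ℕ) → ℝ := fun U => ∑ k, Q U (g k) (P k) with hΦ
  set Ψ : (ι → Finset ℕ) → ℝ :=
    fun U => Φ U + lam * Real.log ((Fintype.piFinset U).card : ℝ) with hΨ
  set BX : Finset (ι → Finset ℕ) :=
    (Fintype.piFinset (fun i => (V i).powerset)).filter (fun U => ∀ i, (U i).Nonempty) with hBX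
  have hVB : V ∈ BX := by simp [hBX, hV]
  obtain ⟨U, hUB, hmax⟩ := Finset.exists_max_image BX Ψ ⟨V, hVB⟩
  simp only [hBX, Finset.mem_filter, Fintype.mem_piFinset, Finset.mem_powerset] at hUB hmax
  obtain ⟨hUV, hU⟩ := hUB
  have cV := pi_card_pos hV
  have cU := pi_card_pos hU
  have hsize : Real.exp (-(M / lam)) * ((Fintype.piFinset V).card : ℝ)
      ≤ ((Fintype.piFinset U).card : ℝ) := by
    have h1 := hmax V ⟨fun i => subset_rfl, hV⟩
    simp only [hΨ] at h1
    have h2 : Φ U ≤ M := by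
      rw [hΦ, hM]
      calc ∑ k, Q U (g k) (P k) ≤ ∑ k : κ, (1 : ℝ) :=
            Finset.sum_le_sum fun k _ => Q_le_one hU (hg0 k) (hg1 k) _
        _ = _ := by simp
    have h3 : 0 ≤ Φ V := Finset.sum_nonneg fun k _ => Q_nonneg _ _ _
    have h4 : -(M / lam) + Real.log ((Fintype.piFinset V).card : ℝ)
        ≤ Real.log ((Fintype.piFinset U).card : ℝ) := by
      have : lam * (-(M / lam) + Real.log ((Fintype.piFinset V).card : ℝ))
          ≤ lam * Real.log ((Fintype.piFinset U).card : ℝ) := by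
        have e : lam * (M / lam) = M := by field_simp
        rw [mul_add, mul_neg, e]; linarith
      exact le_of_mul_le_mul_left this hlampos
    calc _ = Real.exp (-(M / lam) + Real.log ((Fintype.piFinset V).card : ℝ)) := by
            rw [Real.exp_add, Real.exp_log cV]
      _ ≤ Real.exp (Real.log ((Fintype.piFinset U).card : ℝ)) := Real.exp_le_exp.2 h4
      _ = _ := Real.exp_log cU
  refine ⟨U, hUV, hU, hsize, ?_, ?_⟩
  · intro i
    have h1 : (Fintype.piFinset U).card * (V i).card ≤ (Fintype.piFinset V).card * (U i).card := by
      rw [Fintype.card_piFinset, Fintype.card_piFinset,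
        ← Finset.mul_prod_erase Finset.univ (fun i => (U i).card) (Finset.mem_univ i),
        ← Finset.mul_prod_erase Finset.univ (fun i => (V i).card) (Finset.mem_univ i)]
      have : ∏ x ∈ Finset.univ.erase i, (U x).card ≤ ∏ x ∈ Finset.univ.erase i, (V x).card :=
        Finset.prod_le_prod' fun j _ => Finset.card_le_card (hUV j)
      calc _ = (U i).card * (V i).card * ∏ x ∈ Finset.univ.erase i, (U x).card := by ring
        _ ≤ (U i).card * (V i).card * ∏ x ∈ Finset.univ.erase i, (V x).card :=
          Nat.mul_le_mul_left _ this
        _ = _ := by ring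
    have h2 : ((Fintype.piFinset U).card : ℝ) * (V i).card
        ≤ ((Fintype.piFinset V).card : ℝ) * (U i).card := by exact_mod_cast h1
    have h3 : (Real.exp (-(M / lam)) * ((V i).card : ℝ)) * ((Fintype.piFinset V).card : ℝ)
        ≤ ((U i).card : ℝ) * ((Fintype.piFinset V).card : ℝ) := by
      calc _ = (Real.exp (-(M / lam)) * ((Fintype.piFinset V).card : ℝ)) * ((V i).card : ℝ) := by
            ring
        _ ≤ ((Fintype.piFinset U).card : ℝ) * (V i).card := by gcongr
        _ ≤ _ := by linarith
    exact le_of_mul_le_mul_right h3 cV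
  · -- sub-box bound
    have hsub : ∀ b : ι → Finset ℕ, (∀ i, b i ⊆ U i) →
        ((Fintype.piFinset b).card : ℝ) * Φ b
          ≤ ((Fintype.piFinset b).card : ℝ) * Φ U + lam * ((Fintype.piFinset U).card : ℝ) := by
      intro b hb
      by_cases hbn : ∀ i, (b i).Nonempty
      · have cb := pi_card_pos hbn
        have h1 := hmax b ⟨fun i => (hb i).trans (hUV i), hbn⟩
        simp only [hΨ] at h1
        have h2 : Real.log ((Fintype.piFinset U).card : ℝ) - Real.log ((Fintype.piFinset b).card : ℝ)
            ≤ ((Fintype.piFinset U).card : ℝ) / ((Fintype.piFinset b).card : ℝ) := by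
          rw [← Real.log_div cU.ne' cb.ne']
          have := Real.log_le_sub_one_of_pos (div_pos cU cb)
          linarith
        have h3 : Φ b ≤ Φ U + lam * (((Fintype.piFinset U).card : ℝ) / ((Fintype.piFinset b).card : ℝ)) := by
          have := mul_le_mul_of_nonneg_left h2 hlampos.le
          rw [mul_sub] at this
          linarith
        calc _ ≤ ((Fintype.piFinset b).card : ℝ) * (Φ U + lam * (((Fintype.piFinset U).card : ℝ) / ((Fintype.piFinset b).card : ℝ))) := by gcongr
          _ = _ := by field_simp
      · have : Fintype.piFinset b = ∅ := by
          rw [← Finset.not_nonempty_iff_eq_empty, Fintype.piFinset_nonempty]; exact hbn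
        simp only [this, Finset.card_empty, Nat.cast_zero, zero_mul, zero_add]
        positivity
    -- one sided
    have one : ∀ k, ∀ s : (ι → ℕ) → ℝ, (∀ x, |s x| ≤ 1) → Dep s (P k) → ∀ A : ι → Set ℕ,
        EU U (fun x => (g k x - cnd U (g k) (P k) x) * (s x * ind A x)) ≤ ε := by
      intro k s hs1 hs A
      by_contra hcon
      push Not at hcon
      have hg1 := gain U A (g k) s (P k) hs1 hs ε
      have hg2 : ∀ k', ((Fintype.piFinset U).card : ℝ) * Q U (g k') (P k')
          ≤ ∑ S : Finset ι, ((Fintype.piFinset (sb U A S)).card : ℝ) * Q (sb U A S) (g k') (P k') := by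
        intro k'
        have := gain U A (g k') (fun _ => 0) (P k') (by simp) (fun _ _ _ => rfl) 0
        simpa using this
      have hsum : ∑ S : Finset ι, ((Fintype.piFinset (sb U A S)).card : ℝ) * Φ (sb U A S)
          ≤ ((Fintype.piFinset U).card : ℝ) * Φ U + n2 * (lam * ((Fintype.piFinset U).card : ℝ)) := by
        refine le_trans (Finset.sum_le_sum fun S _ => hsub _ (sb_subset U A S)) ?_
        rw [Finset.sum_add_distrib, ← Finset.sum_mul]
        have : ∑ S : Finset ι, ((Fintype.piFinset (sb U A S)).card : ℝ)
            = ((Fintype.piFinset U).card : ℝ) := by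
          have := split_sum U A (fun _ => 1)
          simpa using this.symm
        rw [this]
        simp [hn2]
      have hswap : ∑ S : Finset ι, ((Fintype.piFinset (sb U A S)).card : ℝ) * Φ (sb U A S)
          = ∑ k', ∑ S : Finset ι, ((Fintype.piFinset (sb U A S)).card : ℝ)
              * Q (sb U A S) (g k') (P k') := by
        rw [Finset.sum_comm]
        refine Finset.sum_congr rfl fun S _ => ?_
        rw [hΦ, Finset.mul_sum]
      have hlow : ((Fintype.piFinset U).card : ℝ) * Φ U + ε ^ 2 * ((Fintype.piFinset U).card : ℝ)
          ≤ ∑ k', ∑ S : Finset ι, ((Fintype.piFinset (sb U A S)).card : ℝ)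
              * Q (sb U A S) (g k') (P k') := by
        rw [hΦ, Finset.mul_sum, ← Finset.add_sum_erase _ _ (Finset.mem_univ k),
          ← Finset.add_sum_erase _ (fun k' => ∑ S : Finset ι, ((Fintype.piFinset (sb U A S)).card : ℝ)
              * Q (sb U A S) (g k') (P k')) (Finset.mem_univ k)]
        have hr := Finset.sum_le_sum fun k' (_ : k' ∈ Finset.univ.erase k) => hg2 k'
        have hk : ε * ((Fintype.piFinset U).card : ℝ)
            ≤ ∑ x ∈ Fintype.piFinset U, (g k x - cnd U (g k) (P k) x) * (s x * ind A x) := by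
          rw [← EU_mul_card hU]; gcongr
        have := mul_le_mul_of_nonneg_left hk hε.le
        nlinarith
      have e : n2 * (lam * ((Fintype.piFinset U).card : ℝ))
          = ε ^ 2 / 2 * ((Fintype.piFinset U).card : ℝ) := by
        rw [hlam]; field_simp
      rw [hswap, e] at hsum
      have : 0 < ε ^ 2 * ((Fintype.piFinset U).card : ℝ) := by positivity
      linarith
    intro k s hs1 hs A
    rw [abs_le]
    refine ⟨?_, one k s hs1 hs A⟩
    have h := one k (fun x => -s x) (by simpa using hs1)
      (fun x y hxy => by simp only [hs x y hxy]) A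
    have e : EU U (fun x => (g k x - cnd U (g k) (P k) x) * (-s x * ind A x))
        = - EU U (fun x => (g k x - cnd U (g k) (P k) x) * (s x * ind A x)) := by
      rw [← neg_one_mul, ← EU_cmul]; congr 1; ext x; ring
    rw [e] at h
    linarith

/-- product test functions -/
lemma Reg.prod {U : ι → Finset ℕ} {g : (ι → ℕ) → ℝ} {P : Finset ι} {ε : ℝ}
    (h : Reg U g P ε) {J : Type*} (T : Finset J) (R : J → (ι → ℕ) → ℝ)
    (hR : ∀ j ∈ T, ((∀ x, |R j x| ≤ 1) ∧ Dep (R j) P) ∨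
      ((∀ x, R j x = 0 ∨ R j x = 1) ∧ ∃ i, Dep (R j) {i})) :
    |EU U (fun x => (g x - cnd U g P x) * ∏ j ∈ T, R j x)| ≤ ε := by
  classical
  set T1 := T.filter (fun j => (∀ x, |R j x| ≤ 1) ∧ Dep (R j) P) with hT1
  set T2 := T.filter (fun j => ¬ ((∀ x, |R j x| ≤ 1) ∧ Dep (R j) P)) with hT2
  have h2 : ∀ j ∈ T2, (∀ x, R j x = 0 ∨ R j x = 1) ∧ ∃ i, Dep (R j) {i} := by
    intro j hj
    simp only [hT2, Finset.mem_filter] at hj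
    exact (hR j hj.1).resolve_left hj.2
  let A : ι → Set ℕ := fun i => {a | ∀ j ∈ T2, Dep (R j) {i} → R j (fun _ => a) = 1}
  have key := h (fun x => ∏ j ∈ T1, R j x) (by
      intro x
      rw [Finset.abs_prod]
      apply Finset.prod_le_one
      · intros; positivity
      · intro j hj
        simp only [hT1, Finset.mem_filter] at hj
        exact hj.2.1 x) (by
      intro x y hxy
      apply Finset.prod_congr rfl
      intro j hj
      simp only [hT1, Finset.mem_filter] at hj
      exact hj.2.2 x y hxy) A
  convert key using 4 with x
  rw [← Finset.prod_filter_mul_prod_filter_not T (fun j => (∀ x, |R j x| ≤ 1) ∧ Dep (R j) P)]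
  unfold ind
  change _ * ((∏ j ∈ T1, R j x) * (∏ j ∈ T2, R j x)) = _ * ((∏ j ∈ T1, R j x) * _)
  congr 2
  split_ifs with hA
  · apply Finset.prod_eq_one
    intro j hj
    obtain ⟨h01, i, hi⟩ := h2 j hj
    rw [hi x (fun _ => x i) (by simp)]
    exact hA i j hj hi
  · push Not at hA
    obtain ⟨i, hi⟩ := hA
    simp only [A, Set.mem_ofPred_eq, not_forall] at hi
    obtain ⟨j, hj, hd, hne⟩ := hi
    apply Finset.prod_eq_zero hj
    rw [hd x (fun _ => x i) (by simp)]
    exact ((h2 j hj).1 _).resolve_right hne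

lemma Dep.piecewise {f : (ι → ℕ) → ℝ} {D : Finset ι} (h : Dep f D) (C : Finset ι) (z : ι → ℕ) :
    Dep (fun x => f (C.piecewise x z)) (D ∩ C) := by
  intro x y hxy
  apply h
  intro i hi
  by_cases hC : i ∈ C
  · simp [hC, hxy i (by simp [hi, hC])]
  · simp [hC]

lemma dep_of_card_le_one {f : (ι → ℕ) → ℝ} {D : Finset ι} (h : Dep f D) (hD : D.card ≤ 1)
    (hne : Nonempty ι) : ∃ i, Dep f {i} := by
  have := hne
  rw [Finset.card_le_one_iff_subset_singleton] at hD
  obtain ⟨i, hi⟩ := hD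
  exact ⟨i, h.mono hi⟩

/-- product test functions, localised -/
lemma Reg.prod' {U : ι → Finset ℕ} (hU : ∀ i, (U i).Nonempty) (hne : Nonempty ι)
    {g : (ι → ℕ) → ℝ} {P C : Finset ι} {ε : ℝ} (hgC : Dep g C) (hPC : P ⊆ C)
    (h : Reg U g P ε) {J : Type*} (T : Finset J) (R : J → (ι → ℕ) → ℝ) (D : J → Finset ι)
    (hD : ∀ j ∈ T, Dep (R j) (D j))
    (hR : ∀ j ∈ T, ((∀ x, |R j x| ≤ 1) ∧ D j ∩ C ⊆ P) ∨
      ((∀ x, R j x = 0 ∨ R j x = 1) ∧ (D j ∩ C).card ≤ 1)) :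
    |EU U (fun x => (g x - cnd U g P x) * ∏ j ∈ T, R j x)| ≤ ε := by
  rw [← EU_mix hU C]
  apply EU_abs_le hU
  intro z
  have := h.prod T (fun j x => R j (C.piecewise x z)) (by
    intro j hj
    rcases hR j hj with ⟨h1, h2⟩ | ⟨h1, h2⟩
    · exact Or.inl ⟨fun x => h1 _, ((hD j hj).piecewise C z).mono h2⟩
    · exact Or.inr ⟨fun x => h1 _, dep_of_card_le_one ((hD j hj).piecewise C z) h2 hne⟩)
  convert this using 4 with x
  rw [hgC (C.piecewise x z) x (by intro i hi; simp [hi]),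
    Dep.cnd U g P (C.piecewise x z) x (by intro i hi; simp [hPC hi])]

end Box2

lemma ramsey_step (s : ℕ) (κ : Type) [Finite κ]
    (ih : ∀ K : ℕ, ∃ N, ∀ S : Finset ℕ, N ≤ S.card → ∀ c : Finset ℕ → κ,
      ∃ T ⊆ S, T.card = K ∧ ∃ col, ∀ A ⊆ T, A.card = s → c A = col) (L : ℕ) :
    ∃ N, ∀ S : Finset ℕ, N ≤ S.card → ∀ c : Finset ℕ → κ,
      ∃ T ⊆ S, T.card = L ∧ ∃ col : ℕ → κ, ∀ a ∈ T, ∀ B ⊆ T, B.card = s → (∀ b ∈ B, a < b) →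
        c (insert a B) = col a := by
  classical
  induction L with
  | zero =>
    refine ⟨0, fun S _ c => ⟨∅, by simp, by simp, fun _ => c ∅, by simp⟩⟩
  | succ L ihL =>
    obtain ⟨N, hN⟩ := ihL
    obtain ⟨M, hM⟩ := ih N
    refine ⟨M + 1, fun S hS c => ?_⟩
    have hne : S.Nonempty := by rw [← Finset.card_pos]; omega
    set a := S.min' hne with ha
    have haS : a ∈ S := Finset.min'_mem _ _
    obtain ⟨T1, hT1, hc1, col0, h0⟩ := hM (S.erase a) (by rw [Finset.card_erase_of_mem haS]; omega)
      (fun B => c (insert a B))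
    obtain ⟨T2, hT2, hc2, col, h2⟩ := hN T1 hc1.ge c
    have haT2 : a ∉ T2 := fun h => by simpa using hT1 (hT2 h)
    have hlt : ∀ b ∈ T2, a < b := by
      intro b hb
      have hb' := hT1 (hT2 hb)
      rw [Finset.mem_erase] at hb'
      exact lt_of_le_of_ne (Finset.min'_le _ _ hb'.2) (Ne.symm hb'.1)
    refine ⟨insert a T2, ?_, by rw [Finset.card_insert_of_notMem haT2, hc2],
      Function.update col a col0, ?_⟩
    · intro x hx
      rcases Finset.mem_insert.1 hx with rfl | hx
      · exact haS
      · exact Finset.mem_of_mem_erase (hT1 (hT2 hx))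
    · intro x hx B hB hBs hlt'
      rcases Finset.mem_insert.1 hx with rfl | hx
      · rw [Function.update_self]
        apply h0 _ _ hBs
        intro y hy
        rcases Finset.mem_insert.1 (hB hy) with rfl | hy'
        · exact absurd (hlt' _ hy) (lt_irrefl _)
        · exact hT2 hy'
      · rw [Function.update_of_ne (hlt x hx).ne']
        apply h2 x hx _ _ hBs hlt'
        intro y hy
        rcases Finset.mem_insert.1 (hB hy) with rfl | hy'
        · exact absurd (hlt' _ hy) (lt_asymm (hlt x hx))
        · exact hy'

lemma ramsey_set (s : ℕ) (κ : Type) [Finite κ] : ∀ K : ℕ,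
    ∃ N, ∀ S : Finset ℕ, N ≤ S.card → ∀ c : Finset ℕ → κ,
      ∃ T ⊆ S, T.card = K ∧ ∃ col, ∀ A ⊆ T, A.card = s → c A = col := by
  classical
  induction s with
  | zero =>
    intro K
    refine ⟨K, fun S hS c => ?_⟩
    obtain ⟨T, hT, hc⟩ := Finset.exists_subset_card_eq hS
    refine ⟨T, hT, hc, c ∅, fun A _ hA => ?_⟩
    rw [Finset.card_eq_zero.1 hA]
  | succ s ih =>
    intro K
    have := Fintype.ofFinite κ
    obtain ⟨N, hN⟩ := ramsey_step s κ ih (Fintype.card κ * K)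
    refine ⟨N, fun S hS c => ?_⟩
    obtain ⟨T, hT, hTc, col, hcol⟩ := hN S hS c
    have : Nonempty κ := ⟨c ∅⟩
    obtain ⟨k, -, hk⟩ := Finset.exists_le_card_fiber_of_mul_le_card_of_maps_to
      (s := T) (t := (Finset.univ : Finset κ)) (f := col) (n := K) (fun _ _ => Finset.mem_univ _)
      Finset.univ_nonempty (by rw [hTc, Finset.card_univ])
    obtain ⟨T', hT', hc'⟩ := Finset.exists_subset_card_eq hk
    refine ⟨T', fun x hx => hT (Finset.mem_filter.1 (hT' hx)).1, hc', k, fun A hA hAc => ?_⟩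
    have hne : A.Nonempty := by rw [← Finset.card_pos]; omega
    set a := A.min' hne
    have haA : a ∈ A := Finset.min'_mem _ _
    have h1 := hcol a (Finset.mem_filter.1 (hT' (hA haA))).1 (A.erase a)
      (fun x hx => (Finset.mem_filter.1 (hT' (hA (Finset.mem_of_mem_erase hx)))).1)
      (by rw [Finset.card_erase_of_mem haA]; omega)
      (fun b hb => lt_of_le_of_ne (Finset.min'_le _ _ (Finset.mem_of_mem_erase hb))
        (Ne.symm (Finset.ne_of_mem_erase hb)))
    rw [Finset.insert_erase haA] at h1
    rw [h1, (Finset.mem_filter.1 (hT' (hA haA))).2]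

/-- Ramsey theorem for increasing tuples. -/
lemma ramsey (s : ℕ) (κ : Type) [Finite κ] [Nonempty κ] (K : ℕ) :
    ∃ N₀, ∀ N, N₀ ≤ N → ∀ c : (Fin s → Fin N) → κ, ∃ g : Fin K → Fin N, StrictMono g ∧
      ∃ col, ∀ t : Fin s → Fin K, StrictMono t → c (g ∘ t) = col := by
  classical
  obtain ⟨N₀, hN⟩ := ramsey_set s (Option κ) K
  refine ⟨N₀, fun N hle c => ?_⟩
  let c' : Finset ℕ → Option κ := fun A =>
    if h : A.card = s ∧ ∀ a ∈ A, a < N then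
      some (c (fun i => ⟨A.orderEmbOfFin h.1 i, h.2 _ (Finset.orderEmbOfFin_mem _ _ _)⟩)) else none
  obtain ⟨T, hT, hTc, col, hcol⟩ := hN (Finset.range N) (by simpa using hle) c'
  have hTN : ∀ a ∈ T, a < N := fun a ha => by simpa using hT ha
  let g : Fin K → Fin N := fun i => ⟨T.orderEmbOfFin hTc i, hTN _ (Finset.orderEmbOfFin_mem _ _ _)⟩
  have hg : StrictMono g := fun i j hij => by
    simp only [g, Fin.mk_lt_mk]; exact (T.orderEmbOfFin hTc).strictMono hij
  have key : ∀ t : Fin s → Fin K, StrictMono t → some (c (g ∘ t)) = col := by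
    intro t ht
    set A : Finset ℕ := Finset.univ.image (fun i => ((g (t i) : Fin N) : ℕ)) with hA
    have hmono : StrictMono (fun i => ((g (t i) : Fin N) : ℕ)) := fun i j hij => hg (ht hij)
    have hAc : A.card = s := by
      rw [hA, Finset.card_image_of_injective _ hmono.injective]; simp
    have hAT : A ⊆ T := by
      intro a ha
      simp only [hA, Finset.mem_image] at ha
      obtain ⟨i, -, rfl⟩ := ha
      exact Finset.orderEmbOfFin_mem _ _ _
    have h1 := hcol A hAT hAc
    have h2 : A.card = s ∧ ∀ a ∈ A, a < N := ⟨hAc, fun a ha => hTN a (hAT ha)⟩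
    simp only [c', dif_pos h2] at h1
    rw [← h1]
    congr 2
    funext i
    apply Fin.ext
    have := Finset.orderEmbOfFin_unique hAc (f := fun i => ((g (t i) : Fin N) : ℕ))
      (fun i => by simp only [hA]; exact Finset.mem_image_of_mem _ (Finset.mem_univ _)) hmono
    exact congrFun this i
  by_cases hex : ∃ t : Fin s → Fin K, StrictMono t
  · obtain ⟨t0, ht0⟩ := hex
    refine ⟨g, hg, c (g ∘ t0), fun t ht => ?_⟩
    have := (key t ht).trans (key t0 ht0).symm
    exact Option.some_injective _ this
  · exact ⟨g, hg, Classical.arbitrary κ, fun t ht => absurd ⟨t, ht⟩ hex⟩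

section Box3
variable {ι : Type*} [Fintype ι] [DecidableEq ι]

lemma Reg.prod_extra {U : ι → Finset ℕ} (hU : ∀ i, (U i).Nonempty) (hne : Nonempty ι)
    {g : (ι → ℕ) → ℝ} {P C : Finset ι} {ε : ℝ} (hgC : Dep g C) (hPC : P ⊆ C)
    (h : Reg U g P ε) (s : (ι → ℕ) → ℝ) (D0 : Finset ι) (hs1 : ∀ x, |s x| ≤ 1) (hs : Dep s D0)
    (hD0 : D0 ∩ C ⊆ P)
    {J : Type*} (T : Finset J) (R : J → (ι → ℕ) → ℝ) (D : J → Finset ι)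
    (hD : ∀ j ∈ T, Dep (R j) (D j))
    (hR : ∀ j ∈ T, (∀ x, R j x = 0 ∨ R j x = 1) ∧ (D j ∩ C).card ≤ 1) :
    |EU U (fun x => (g x - cnd U g P x) * (s x * ∏ j ∈ T, R j x))| ≤ ε := by
  have := Reg.prod' hU hne hgC hPC h (Finset.insertNone T)
    (fun o => o.elim s R) (fun o => o.elim D0 D) (by
      intro j hj
      cases j with
      | none => exact hs
      | some j => exact hD j (by simpa using hj)) (by
      intro j hj
      cases j with
      | none => exact Or.inl ⟨hs1, hD0⟩
      | some j => exact Or.inr (hR j (by simpa using hj)))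
  simpa [Finset.prod_insertNone] using this

lemma abs_le_one_of_01 {a : ℝ} (h : a = 0 ∨ a = 1) : |a| ≤ 1 := by
  rcases h with h | h <;> simp [h]

lemma pair_removal {U : ι → Finset ℕ} (hU : ∀ i, (U i).Nonempty) (hne : Nonempty ι)
    {ge gf : (ι → ℕ) → ℝ} {e f P : Finset ι} {ε : ℝ} (hge : Dep ge e) (hgf : Dep gf f)
    (hP : e ∩ f = P) (he01 : ∀ x, ge x = 0 ∨ ge x = 1) (hf01 : ∀ x, gf x = 0 ∨ gf x = 1)
    (hre : Reg U ge P ε) (hrf : Reg U gf P ε) (href : Reg U (fun x => ge x * gf x) ∅ ε)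
    {J : Type*} (T : Finset J) (R : J → (ι → ℕ) → ℝ) (D : J → Finset ι)
    (hD : ∀ j ∈ T, Dep (R j) (D j)) (h01 : ∀ j ∈ T, ∀ x, R j x = 0 ∨ R j x = 1)
    (hDe : ∀ j ∈ T, (D j ∩ e).card ≤ 1) (hDf : ∀ j ∈ T, (D j ∩ f).card ≤ 1) :
    |EU U (fun x => ge x * gf x * ∏ j ∈ T, R j x)
      - EU U (fun x => ge x * gf x) * EU U (fun x => ∏ j ∈ T, R j x)| ≤ 3 * ε := by
  have hPe : P ⊆ e := hP ▸ Finset.inter_subset_left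
  have hPf : P ⊆ f := hP ▸ Finset.inter_subset_right
  have hfe : f ∩ e = P := by rw [Finset.inter_comm]; exact hP
  have habs : ∀ x, |cnd U ge P x| ≤ 1 := fun x => by
    rw [abs_le]
    have h1 := cnd_nonneg (U := U) (g := ge) (fun x => by rcases he01 x with h | h <;> simp [h]) P x
    have h2 := cnd_le_one hU (g := ge) (fun x => by rcases he01 x with h | h <;> simp [h]) P x
    constructor <;> linarith
  have s1 := Reg.prod_extra hU hne hge hPe hre gf f (fun x => abs_le_one_of_01 (hf01 x)) hgf
    hfe.subset T R D hD (fun j hj => ⟨h01 j hj, hDe j hj⟩)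
  have s2 := Reg.prod_extra hU hne hgf hPf hrf (cnd U ge P) P habs (Dep.cnd U ge P)
    Finset.inter_subset_left T R D hD (fun j hj => ⟨h01 j hj, hDf j hj⟩)
  set t := EU U (fun x => ge x * gf x) with ht
  have s3 : |EU U (fun x => cnd U ge P x * cnd U gf P x * ∏ j ∈ T, R j x)
      - t * EU U (fun x => ∏ j ∈ T, R j x)| ≤ ε := by
    rw [← EU_mix hU P (fun x => cnd U ge P x * cnd U gf P x * ∏ j ∈ T, R j x),
      ← EU_mix hU P (fun x => ∏ j ∈ T, R j x), ← EU_cmul, ← EU_sub]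
    apply EU_abs_le hU
    intro z
    set Rz : (ι → ℕ) → ℝ := fun x => ∏ j ∈ T, R j (P.piecewise x z) with hRz
    have hdep : Dep Rz P := by
      intro x y hxy
      simp only [hRz]
      refine Finset.prod_congr rfl fun j hj => ?_
      congr 1; ext i; by_cases hi : i ∈ P <;> simp [hi, hxy]
    have e1 : EU U (fun x => cnd U ge P (P.piecewise x z) * cnd U gf P (P.piecewise x z)
          * ∏ j ∈ T, R j (P.piecewise x z))
        = EU U (fun x => ge x * gf x * Rz x) := by
      have a1 := EU_proj hU hgf (s := fun x => ge x * Rz x) (hge.mul (hdep.mono hPe)) hfe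
      have a2 := EU_proj hU hge (s := fun x => cnd U gf P x * Rz x)
        ((Dep.cnd U gf P).mul hdep) (Finset.inter_eq_right.2 hPe)
      calc _ = EU U (fun x => cnd U ge P x * (cnd U gf P x * Rz x)) := by
            congr 1; ext x
            rw [Dep.cnd U ge P (P.piecewise x z) x (by intro i hi; simp [hi]),
              Dep.cnd U gf P (P.piecewise x z) x (by intro i hi; simp [hi])]
            simp only [hRz]; ring
        _ = EU U (fun x => ge x * (cnd U gf P x * Rz x)) := a2.symm
        _ = EU U (fun x => cnd U gf P x * (ge x * Rz x)) := by congr 1; ext x; ring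
        _ = EU U (fun x => gf x * (ge x * Rz x)) := a1.symm
        _ = _ := by congr 1; ext x; ring
    rw [e1, ← EU_cmul, ← EU_sub]
    have := href.prod T (fun j x => R j (P.piecewise x z)) (by
      intro j hj
      refine Or.inr ⟨fun x => h01 j hj _, dep_of_card_le_one ((hD j hj).piecewise P z) ?_ hne⟩
      refine le_trans (Finset.card_le_card ?_) (hDe j hj)
      exact Finset.inter_subset_inter_left hPe)
    convert this using 3
    ext x
    rw [cnd_empty, ← ht]
    simp only [hRz]; ring
  have e : EU U (fun x => ge x * gf x * ∏ j ∈ T, R j x)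
      = EU U (fun x => (ge x - cnd U ge P x) * (gf x * ∏ j ∈ T, R j x))
        + EU U (fun x => (gf x - cnd U gf P x) * (cnd U ge P x * ∏ j ∈ T, R j x))
        + EU U (fun x => cnd U ge P x * cnd U gf P x * ∏ j ∈ T, R j x) := by
    rw [← EU_add, ← EU_add]; congr 1; ext x; ring
  rw [e]
  rw [abs_le] at *
  constructor <;> linarith [s1.1, s1.2, s2.1, s2.2, s3.1, s3.2]

/-- Counting for a twin-closed family. `h` the indicator functions, indexed by `J`. -/
lemma twin_count {U : ι → Finset ℕ} (hU : ∀ i, (U i).Nonempty) (hne : Nonempty ι)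
    {J : Type*} [DecidableEq J] (h : J → (ι → ℕ) → ℝ) (D : J → Finset ι) (tw : J → J)
    (ε δ : ℝ) (hε : 0 ≤ ε) (hδ0 : 0 ≤ δ) (hδ1 : δ ≤ 1) (E : Finset J)
    (htwE : ∀ j ∈ E, tw j ∈ E) (htw2 : ∀ j ∈ E, tw (tw j) = j) (htwne : ∀ j ∈ E, tw j ≠ j)
    (hD : ∀ j, Dep (h j) (D j)) (h01 : ∀ j x, h j x = 0 ∨ h j x = 1)
    (hlin : ∀ j ∈ E, ∀ k ∈ E, k ≠ j → k ≠ tw j → (D k ∩ D j).card ≤ 1)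
    (hr1 : ∀ j k, Reg U (h j) (D j ∩ D k) ε) (hr2 : ∀ j k, Reg U (fun x => h j x * h k x) ∅ ε)
    (ht : ∀ j ∈ E, δ ≤ EU U (fun x => h j x * h (tw j) x)) :
    ∀ n, ∀ S ⊆ E, S.card = n → (∀ j ∈ S, tw j ∈ S) →
      δ ^ S.card - 3 * ε * S.card ≤ EU U (fun x => ∏ j ∈ S, h j x) := by
  intro n
  induction n using Nat.strong_induction_on with
  | _ n ih =>
  intro S hSE hSn hS
  rcases S.eq_empty_or_nonempty with rfl | ⟨e, he⟩
  · simp [EU_const hU]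
  · set f := tw e with hf
    have hfS : f ∈ S := hS e he
    have hfe : f ≠ e := htwne e (hSE he)
    set S' := (S.erase e).erase f with hS'
    have hfS1 : f ∈ S.erase e := Finset.mem_erase.2 ⟨hfe, hfS⟩
    have c1 : (S.erase e).card + 1 = S.card := Finset.card_erase_add_one he
    have c2 : S'.card + 1 = (S.erase e).card := Finset.card_erase_add_one hfS1
    have hS'S : S' ⊆ S := (Finset.erase_subset _ _).trans (Finset.erase_subset _ _)
    have mem' : ∀ j ∈ S', j ≠ f ∧ j ≠ e ∧ j ∈ S := by
      intro j hj; simpa [hS'] using hj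
    have IH := ih S'.card (by omega) S' (hS'S.trans hSE) rfl (by
      intro j hj
      obtain ⟨h1, h2, h3⟩ := mem' j hj
      simp only [hS', Finset.mem_erase]
      refine ⟨fun h => h2 ?_, fun h => h1 ?_, hS j h3⟩
      · rw [← htw2 j (hSE h3), h, hf, htw2 e (hSE he)]
      · rw [← htw2 j (hSE h3), h])
    have key := pair_removal hU hne (hD e) (hD f) rfl (h01 e) (h01 f) (hr1 e f)
      (by rw [Finset.inter_comm]; exact hr1 f e) (hr2 e f) S' h D (fun j _ => hD j)
      (fun j _ => h01 j)
      (fun j hj => hlin e (hSE he) j (hSE (mem' j hj).2.2) (mem' j hj).2.1 (mem' j hj).1)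
      (fun j hj => hlin f (hSE hfS) j (hSE (mem' j hj).2.2) (mem' j hj).1
        (by rw [hf, htw2 e (hSE he)]; exact (mem' j hj).2.1))
    have e1 : (fun x => ∏ j ∈ S, h j x) = fun x => h e x * h f x * ∏ j ∈ S', h j x := by
      ext x
      rw [← Finset.mul_prod_erase S _ he, ← Finset.mul_prod_erase _ _ hfS1, ← mul_assoc]
    rw [e1]
    have hE0 : 0 ≤ EU U (fun x => ∏ j ∈ S', h j x) := EU_nonneg fun x =>
      Finset.prod_nonneg fun j _ => by rcases h01 j x with h | h <;> simp [h]
    have t1 := mul_le_mul_of_nonneg_right (ht e (hSE he)) hE0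
    have t2 := mul_le_mul_of_nonneg_left IH hδ0
    have t3 : (S.card : ℝ) = S'.card + 2 := by rw [← c1, ← c2]; push_cast; ring
    have t4 : δ ^ S.card ≤ δ * δ ^ S'.card := by
      rw [← pow_succ']
      exact pow_le_pow_of_le_one hδ0 hδ1 (by omega)
    have t5 : δ * (3 * ε * S'.card) ≤ 3 * ε * S'.card :=
      mul_le_of_le_one_left (by positivity) hδ1
    have := (abs_le.1 key).1
    rw [t3]
    nlinarith
end Box3

open Classical in
/-- indicator that the transversal `x` maps `e` to an edge of `H` -/
noncomputable def hE {r N : ℕ} (H : RGraph r) (e : Finset (Fin N)) (x : Fin N → ℕ) : ℝ :=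
  if e.image x ∈ H.edges then 1 else 0

lemma hE_01 {r N : ℕ} (H : RGraph r) (e : Finset (Fin N)) (x : Fin N → ℕ) :
    hE H e x = 0 ∨ hE H e x = 1 := by
  unfold hE; split_ifs <;> simp

lemma hE_nonneg {r N : ℕ} (H : RGraph r) (e : Finset (Fin N)) (x : Fin N → ℕ) :
    0 ≤ hE H e x := by
  rcases hE_01 H e x with h | h <;> simp [h]

lemma hE_le_one {r N : ℕ} (H : RGraph r) (e : Finset (Fin N)) (x : Fin N → ℕ) :
    hE H e x ≤ 1 := by
  rcases hE_01 H e x with h | h <;> simp [h]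

lemma hE_dep {r N : ℕ} (H : RGraph r) (e : Finset (Fin N)) : Dep (hE H e) e := by
  intro x y hxy
  unfold hE
  have : e.image x = e.image y := Finset.image_congr (fun i hi => hxy i hi)
  rw [this]

lemma case_one {r : ℕ} (F : RGraph r) (hql : QuasiLinear F)
    (σ : Fin (2 * r - 2) → Letter) (hadm : AdmitsSeq F σ) (H : RGraph r) {N K1 : ℕ}
    (U : Fin N → Finset ℕ) (hU : ∀ i, (U i).Nonempty) (hUV : ∀ i, U i ⊆ H.verts)
    (hdisj : ∀ i j, i ≠ j → Disjoint (U i) (U j)) (ε δ : ℝ) (hε : 0 ≤ ε) (hδ0 : 0 ≤ δ) (hδ1 : δ ≤ 1)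
    (hεδ : 3 * ε * F.edges.card < δ ^ F.edges.card)
    (hr1 : ∀ e P, Reg U (hE H e) P ε) (hr2 : ∀ e f, Reg U (fun x => hE H e x * hE H f x) ∅ ε)
    (g : Fin K1 → Fin N) (hg : StrictMono g) (hK : F.verts.card < K1)
    (ht : ∀ t : Fin (2 * r - 2) → Fin K1, StrictMono t →
      δ ≤ EU U (fun x =>
        hE H ((Finset.univ.filter (fun i => σ i ≠ Letter.Y)).image (g ∘ t)) x
        * hE H ((Finset.univ.filter (fun i => σ i ≠ Letter.X)).image (g ∘ t)) x)) :
    IsSubgraph F H := by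
  classical
  obtain ⟨ord, hinj, hdesc⟩ := hadm
  let ν : ℕ → Fin K1 := fun v => ⟨(F.verts.filter (fun w => ord w < ord v)).card,
    lt_of_le_of_lt (Finset.card_filter_le _ _) hK⟩
  have hν : ∀ v ∈ F.verts, ∀ w, ord v < ord w → ν v < ν w := by
    intro v hv w hvw
    change (F.verts.filter (fun u => ord u < ord v)).card < (F.verts.filter (fun u => ord u < ord w)).card
    apply Finset.card_lt_card
    rw [Finset.ssubset_iff_of_subset (fun u hu => by
      rw [Finset.mem_filter] at *; exact ⟨hu.1, hu.2.trans hvw⟩)]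
    exact ⟨v, by simp [hv, hvw], by simp⟩
  let μ : ℕ → Fin N := fun v => g (ν v)
  have hμ : Set.InjOn μ ↑F.verts := by
    intro v hv w hw hvw
    by_contra hne
    have h1 : ν v = ν w := hg.injective hvw
    have h2 : ord v ≠ ord w := fun h => hne (hinj hv hw h)
    rcases lt_or_gt_of_ne h2 with h | h
    · exact (hν v hv w h).ne h1
    · exact (hν w hw v h).ne' h1
  have hq' : ∀ e : Finset ℕ, ∃ f, e ∈ F.edges → f ∈ F.edges ∧ f ≠ e ∧ (e ∩ f).card = 2 ∧
      ∀ f' ∈ F.edges, f' ≠ e → f' ≠ f → (e ∩ f').card ≤ 1 := by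
    intro e
    by_cases he : e ∈ F.edges
    · obtain ⟨f, h1, h2⟩ := hql e he
      exact ⟨f, fun _ => ⟨h1, h2⟩⟩
    · exact ⟨∅, fun h => absurd h he⟩
  choose tw htw using hq'
  have hN : Nonempty (Fin N) := ⟨μ 0⟩
  have htwin : ∀ e ∈ F.edges, IsTwin F e (tw e) := fun e he =>
    ⟨he, (htw e he).1, (htw e he).2.1.symm, (htw e he).2.2.1⟩
  have key := twin_count hU hN (fun e : Finset ℕ => hE H (e.image μ)) (fun e => e.image μ) tw
    ε δ hε hδ0 hδ1 F.edges (fun j hj => (htw j hj).1)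
    (by
      intro e he
      obtain ⟨h1, h2, h3, h4⟩ := htw e he
      obtain ⟨h5, h6, h7, h8⟩ := htw (tw e) h1
      by_contra hne
      have := h8 e he h2.symm (Ne.symm hne)
      rw [Finset.inter_comm] at this
      omega)
    (fun j hj => (htw j hj).2.1) (fun j => hE_dep H _) (fun j => hE_01 H _)
    (by
      intro j hj k hk hkj hkt
      have := (htw j hj).2.2.2 k hk hkj hkt
      rw [← Finset.image_inter_of_injOn]
      · rw [Finset.inter_comm]
        exact Finset.card_image_le.trans this
      · apply hμ.mono
        intro v hv
        rcases hv with hv | hv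
        · exact F.edges_subset k hk hv
        · exact F.edges_subset j hj hv)
    (fun j k => hr1 _ _) (fun j k => hr2 _ _)
    (by
      intro e he
      obtain ⟨w, hw1, hw2, hw3⟩ := hdesc e (tw e) (htwin e he)
      have hwV : ∀ i, w i ∈ F.verts := by
        intro i
        have := (hw2 (w i)).2 ⟨i, rfl⟩
        rcases Finset.mem_union.1 this with h | h
        · exact F.edges_subset e he h
        · exact F.edges_subset _ (htw e he).1 h
      have hmono : StrictMono (fun i => ν (w i)) := fun i j hij =>
        hν _ (hwV i) _ (hw1 i j hij)
      have := ht _ hmono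
      have im : ∀ (a : Finset ℕ) (p : Fin (2 * r - 2) → Prop) [DecidablePred p], a ⊆ e ∪ tw e → (∀ i, w i ∈ a ↔ p i) →
          (Finset.univ.filter (fun i => p i)).image (g ∘ (fun i => ν (w i))) = a.image μ := by
        intro a p _ ha hp
        ext y
        simp only [Finset.mem_image, Finset.mem_filter, Finset.mem_univ, true_and]
        constructor
        · rintro ⟨i, hi, rfl⟩
          exact ⟨w i, (hp i).2 hi, rfl⟩
        · rintro ⟨v, hv, rfl⟩
          obtain ⟨i, rfl⟩ := (hw2 v).1 (ha hv)
          exact ⟨i, (hp i).1 hv, rfl⟩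
      rcases hw3 with ⟨h1, h2⟩ | ⟨h1, h2⟩
      · rw [im e (fun i => σ i ≠ Letter.Y) Finset.subset_union_left h1,
          im _ (fun i => σ i ≠ Letter.X) Finset.subset_union_right h2] at this
        exact this
      · rw [im e (fun i => σ i ≠ Letter.X) Finset.subset_union_left h1,
          im _ (fun i => σ i ≠ Letter.Y) Finset.subset_union_right h2] at this
        simpa only [mul_comm] using this)
    _ F.edges subset_rfl rfl (fun j hj => (htw j hj).1)
  have hpos : 0 < EU U (fun x => ∏ j ∈ F.edges, hE H (j.image μ) x) := by linarith
  have hex : ∃ x ∈ Fintype.piFinset U, ∏ j ∈ F.edges, hE H (j.image μ) x ≠ 0 := by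
    by_contra hcon
    push Not at hcon
    have : EU U (fun x => ∏ j ∈ F.edges, hE H (j.image μ) x) = 0 := by
      unfold EU; rw [Finset.sum_eq_zero hcon]; simp
    linarith
  obtain ⟨x, hx, hprod⟩ := hex
  rw [Fintype.mem_piFinset] at hx
  have hxinj : Function.Injective x := by
    intro i j hij
    by_contra hne
    exact Finset.disjoint_left.1 (hdisj i j hne) (hx i) (hij ▸ hx j)
  refine ⟨fun v => x (μ v), ?_, fun v _ => hUV _ (hx _), ?_⟩
  · intro v hv w hw h
    exact hμ hv hw (hxinj h)
  · intro e he
    have h1 := Finset.prod_ne_zero_iff.1 hprod e he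
    unfold hE at h1
    rw [Finset.image_image] at h1
    by_contra hcon
    apply h1
    exact if_neg hcon

lemma exists_sigma {r n : ℕ} (s s' : Fin r → Fin n) (hs : StrictMono s)
    (hs' : StrictMono s') {a b a' b' : Fin r} (hab : a < b) (hab' : a' < b')
    (hne : (a, b) ≠ (a', b')) (h1 : s a = s' a') (h2 : s b = s' b')
    (h3 : ∀ c c', s c = s' c' → c = a ∨ c = b) :
    ∃ σ : Fin (2 * r - 2) → Letter, SeqInconsistent r σ ∧
      ∃ t : Fin (2 * r - 2) → Fin n, StrictMono t ∧
        (Finset.univ.filter (fun i => σ i ≠ Letter.Y)).image t = Finset.univ.image s ∧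
        (Finset.univ.filter (fun i => σ i ≠ Letter.X)).image t = Finset.univ.image s' := by
  classical
  set e := (Finset.univ : Finset (Fin r)).image s with he
  set f := (Finset.univ : Finset (Fin r)).image s' with hf
  have hec : e.card = r := by rw [he, Finset.card_image_of_injective _ hs.injective]; simp
  have hfc : f.card = r := by rw [hf, Finset.card_image_of_injective _ hs'.injective]; simp
  have hef : e ∩ f = {s a, s b} := by
    ext v
    simp only [he, hf, Finset.mem_inter, Finset.mem_image, Finset.mem_univ, true_and,
      Finset.mem_insert, Finset.mem_singleton]
    constructor
    · rintro ⟨⟨c, rfl⟩, ⟨c', hc⟩⟩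
      rcases h3 c c' hc.symm with rfl | rfl <;> simp
    · rintro (rfl | rfl)
      · exact ⟨⟨a, rfl⟩, a', h1.symm⟩
      · exact ⟨⟨b, rfl⟩, b', h2.symm⟩
  have hefc : (e ∩ f).card = 2 := by
    rw [hef, Finset.card_pair (hs.injective.ne hab.ne)]
  have hr2 : 2 ≤ r := by
    rw [← hefc, ← hec]; exact Finset.card_le_card Finset.inter_subset_left
  have hAc : (e ∪ f).card = 2 * r - 2 := by
    have := Finset.card_union_add_card_inter e f
    omega
  set t := (e ∪ f).orderEmbOfFin hAc with ht
  have hrange : ∀ v ∈ e ∪ f, ∃ i, t i = v := by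
    intro v hv
    have := Finset.range_orderEmbOfFin (e ∪ f) hAc
    have hv' : v ∈ Set.range t := by rw [ht, this]; exact hv
    exact hv'
  have htm : ∀ i, t i ∈ e ∪ f := fun i => Finset.orderEmbOfFin_mem _ _ _
  let σ : Fin (2 * r - 2) → Letter := fun i =>
    if t i ∈ e then (if t i ∈ f then Letter.Z else Letter.X) else Letter.Y
  have hX : ∀ i, σ i = Letter.X ↔ t i ∈ e \ f := by
    intro i; simp only [σ, Finset.mem_sdiff]; split_ifs <;> simp_all
  have hY : ∀ i, σ i = Letter.Y ↔ t i ∈ f \ e := by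
    intro i
    have := htm i
    rw [Finset.mem_union] at this
    simp only [σ, Finset.mem_sdiff]; split_ifs <;> simp_all
  have hZ : ∀ i, σ i = Letter.Z ↔ t i ∈ e ∩ f := by
    intro i; simp only [σ, Finset.mem_inter]; split_ifs <;> simp_all
  have hnY : ∀ i, σ i ≠ Letter.Y ↔ t i ∈ e := by
    intro i; rw [Ne, hY, Finset.mem_sdiff]
    have := htm i
    rw [Finset.mem_union] at this
    tauto
  have hnX : ∀ i, σ i ≠ Letter.X ↔ t i ∈ f := by
    intro i; rw [Ne, hX, Finset.mem_sdiff]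
    have := htm i
    rw [Finset.mem_union] at this
    tauto
  have im : ∀ (q : Finset (Fin n)) (p : Fin (2 * r - 2) → Prop) [DecidablePred p], q ⊆ e ∪ f →
      (∀ i, p i ↔ t i ∈ q) → (Finset.univ.filter (fun i => p i)).image t = q := by
    intro q p _ hq hp
    ext v
    simp only [Finset.mem_image, Finset.mem_filter, Finset.mem_univ, true_and]
    constructor
    · rintro ⟨i, hi, rfl⟩; exact (hp i).1 hi
    · intro hv
      obtain ⟨i, rfl⟩ := hrange v (hq hv)
      exact ⟨i, (hp i).2 hv, rfl⟩
  have imc : ∀ (q : Finset (Fin n)) (p : Fin (2 * r - 2) → Prop) [DecidablePred p], q ⊆ e ∪ f →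
      (∀ i, p i ↔ t i ∈ q) → (Finset.univ.filter (fun i => p i)).card = q.card := by
    intro q p _ hq hp
    rw [← im q p hq hp, Finset.card_image_of_injective _ t.injective]
  have sube : e ⊆ e ∪ f := Finset.subset_union_left
  have subf : f ⊆ e ∪ f := Finset.subset_union_right
  have rank : ∀ (u : Fin r → Fin n), StrictMono u → ∀ c,
      (((Finset.univ : Finset (Fin r)).image u).filter (fun v => v < u c)).card = c := by
    intro u hu c
    have : ((Finset.univ : Finset (Fin r)).image u).filter (fun v => v < u c)
        = (Finset.Iio c).image u := by
      ext v
      simp only [Finset.mem_filter, Finset.mem_image, Finset.mem_univ, true_and, Finset.mem_Iio]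
      constructor
      · rintro ⟨⟨d, rfl⟩, hd⟩; exact ⟨d, hu.lt_iff_lt.1 hd, rfl⟩
      · rintro ⟨d, hd, rfl⟩; exact ⟨⟨d, rfl⟩, hu hd⟩
    rw [this, Finset.card_image_of_injective _ hu.injective, Fin.card_Iio]
  have roleY : seqRole r σ Letter.Y = {(a : ℕ) + 1, (b : ℕ) + 1} := by
    have : seqRole r σ Letter.Y
        = (e ∩ f).image (fun v => (e.filter (fun w => w < v)).card + 1) := by
      unfold seqRole
      rw [← im (e ∩ f) (fun i => σ i = Letter.Z)
        (Finset.inter_subset_left.trans sube) hZ, Finset.image_image]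
      refine Finset.image_congr fun i _ => ?_
      simp only [Function.comp]
      congr 1
      apply imc _ _ ((Finset.filter_subset _ _).trans sube)
      intro j
      rw [hnY, Finset.mem_filter, t.lt_iff_lt]
    rw [this, hef, Finset.image_insert, Finset.image_singleton, rank s hs, rank s hs]
  have roleX : seqRole r σ Letter.X = {(a' : ℕ) + 1, (b' : ℕ) + 1} := by
    have : seqRole r σ Letter.X
        = (e ∩ f).image (fun v => (f.filter (fun w => w < v)).card + 1) := by
      unfold seqRole
      rw [← im (e ∩ f) (fun i => σ i = Letter.Z)
        (Finset.inter_subset_left.trans sube) hZ, Finset.image_image]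
      refine Finset.image_congr fun i _ => ?_
      simp only [Function.comp]
      congr 1
      apply imc _ _ ((Finset.filter_subset _ _).trans subf)
      intro j
      rw [hnX, Finset.mem_filter, t.lt_iff_lt]
    rw [this, hef, h1, h2, Finset.image_insert, Finset.image_singleton, rank s' hs', rank s' hs']
  refine ⟨σ, ⟨⟨?_, ?_, ?_⟩, ?_⟩, t, t.strictMono, im _ _ sube hnY, im _ _ subf hnX⟩
  · rw [imc _ _ (Finset.sdiff_subset.trans sube) hX]
    have := Finset.card_sdiff_add_card_inter e f
    omega
  · rw [imc _ _ (Finset.sdiff_subset.trans subf) hY]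
    have := Finset.card_sdiff_add_card_inter f e
    rw [Finset.inter_comm] at this
    omega
  · rw [imc _ _ (Finset.inter_subset_left.trans sube) hZ, hefc]
  · unfold SeqConsistent
    rw [roleY, roleX]
    intro h
    apply hne
    have e1 : ((a : ℕ) + 1) ∈ ({(a' : ℕ) + 1, (b' : ℕ) + 1} : Finset ℕ) := by rw [← h]; simp
    have e2 : ((b : ℕ) + 1) ∈ ({(a' : ℕ) + 1, (b' : ℕ) + 1} : Finset ℕ) := by rw [← h]; simp
    simp only [Finset.mem_insert, Finset.mem_singleton] at e1 e2
    have l1 : (a : ℕ) < b := hab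
    have l2 : (a' : ℕ) < b' := hab'
    ext <;> simp <;> omega

/-- positions of a copy of the role `(a,b)` -/
def posN (r : ℕ) (p : Fin r × Fin r) (c : Fin r) : ℕ :=
  (if c < p.1 then 0 else if c < p.2 then 1 else 2) * (2 + r * r * r + r)
    + (if c = p.1 ∨ c = p.2 then 0 else 1 + (p.1 * r + p.2) * r + c)

lemma posN_off_lt (r : ℕ) (p : Fin r × Fin r) (c : Fin r) :
    1 + ((p.1 : ℕ) * r + p.2) * r + c < 2 + r * r * r + r := by
  have h1 := p.1.2
  have h2 := p.2.2
  have h3 := c.2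
  have : (p.1 : ℕ) * r + p.2 < r * r := by nlinarith
  have : ((p.1 : ℕ) * r + p.2) * r ≤ r * r * r := Nat.mul_le_mul_right _ this.le
  omega

lemma posN_lt (r : ℕ) (p : Fin r × Fin r) (c : Fin r) :
    posN r p c < 3 * (2 + r * r * r + r) := by
  have := posN_off_lt r p c
  unfold posN
  split_ifs <;> omega

lemma posN_mono (r : ℕ) (p : Fin r × Fin r) (hp : p.1 < p.2) : StrictMono (posN r p) := by
  intro c d hcd
  have h1 := posN_off_lt r p c
  have h2 := posN_off_lt r p d
  unfold posN
  have e1 : (p.1 : ℕ) < p.2 := hp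
  have e2 : (c : ℕ) < d := hcd
  simp only [Fin.lt_def, Fin.ext_iff]
  split_ifs <;> omega

lemma posN_fst (r : ℕ) (p : Fin r × Fin r) (hp : p.1 < p.2) :
    posN r p p.1 = 2 + r * r * r + r := by
  unfold posN; simp [hp]

lemma posN_snd (r : ℕ) (p : Fin r × Fin r) (hp : p.1 < p.2) :
    posN r p p.2 = 2 * (2 + r * r * r + r) := by
  unfold posN; simp [hp.le]

lemma posN_eq (r : ℕ) (p q : Fin r × Fin r) (hpq : p ≠ q) (c c' : Fin r)
    (h : posN r p c = posN r q c') : c = p.1 ∨ c = p.2 := by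
  by_contra hc
  have h1 := posN_off_lt r p c
  have h2 := posN_off_lt r q c'
  have key : (if c = p.1 ∨ c = p.2 then 0 else 1 + ((p.1 : ℕ) * r + p.2) * r + c)
      = (if c' = q.1 ∨ c' = q.2 then 0 else 1 + ((q.1 : ℕ) * r + q.2) * r + c') := by
    unfold posN at h
    have m1 : (if c = p.1 ∨ c = p.2 then 0 else 1 + ((p.1 : ℕ) * r + p.2) * r + c)
        < 2 + r * r * r + r := by split_ifs <;> omega
    have m2 : (if c' = q.1 ∨ c' = q.2 then 0 else 1 + ((q.1 : ℕ) * r + q.2) * r + c')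
        < 2 + r * r * r + r := by split_ifs <;> omega
    have : _ % (2 + r * r * r + r) = _ % (2 + r * r * r + r) :=
      congrArg (fun z => z % (2 + r * r * r + r)) h
    have md : ∀ x y : ℕ, y < 2 + r * r * r + r →
        (x * (2 + r * r * r + r) + y) % (2 + r * r * r + r) = y := by
      intro x y hy
      rw [Nat.mul_add_mod', Nat.mod_eq_of_lt hy]
    rw [md _ _ m1, md _ _ m2] at this
    exact this
  rw [if_neg hc] at key
  split_ifs at key
  · omega
  · apply hpq
    have hr : 0 < r := by have := c.2; omega
    have k1 : ((p.1 : ℕ) * r + p.2) * r + c = ((q.1 : ℕ) * r + q.2) * r + c' := by omega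
    have k2 := congrArg (fun z => z / r) k1
    have dv : ∀ x y : ℕ, y < r → (x * r + y) / r = x := by
      intro x y hy
      rw [mul_comm, Nat.mul_add_div hr, Nat.div_eq_of_lt hy, add_zero]
    simp only [dv _ _ c.2, dv _ _ c'.2] at k2
    have k3 := congrArg (fun z => z / r) k2
    simp only [dv _ _ p.2.2, dv _ _ q.2.2] at k3
    have k4 : (p.2 : ℕ) = q.2 := by rw [k3] at k2; omega
    exact Prod.ext (Fin.ext k3) (Fin.ext k4)

section PB
variable {ι : Type*} [Fintype ι] [DecidableEq ι]

lemma EU_subbox {U W : ι → Finset ℕ} (hW : ∀ i, (W i).Nonempty) (hWU : ∀ i, W i ⊆ U i)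
    {c : ℝ} (hc : 0 < c)
    (hcard : c * ((Fintype.piFinset U).card : ℝ) ≤ ((Fintype.piFinset W).card : ℝ))
    (f : (ι → ℕ) → ℝ) (hf : ∀ x, 0 ≤ f x) : EU W f ≤ EU U f / c := by
  have hU : ∀ i, (U i).Nonempty := fun i => (hW i).mono (hWU i)
  have cU := pi_card_pos hU
  have cW := pi_card_pos hW
  rw [le_div_iff₀ hc]
  unfold EU
  rw [le_div_iff₀ cU, div_mul_eq_mul_div, div_mul_eq_mul_div, div_le_iff₀ cW]
  have h1 : ∑ x ∈ Fintype.piFinset W, f x ≤ ∑ x ∈ Fintype.piFinset U, f x :=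
    Finset.sum_le_sum_of_subset_of_nonneg (Fintype.piFinset_subset _ _ hWU) (fun x _ _ => hf x)
  have h0 : 0 ≤ ∑ x ∈ Fintype.piFinset W, f x := Finset.sum_nonneg fun x _ => hf x
  calc _ = (∑ x ∈ Fintype.piFinset W, f x) * (c * ((Fintype.piFinset U).card : ℝ)) := by ring
    _ ≤ (∑ x ∈ Fintype.piFinset W, f x) * ((Fintype.piFinset W).card : ℝ) := by gcongr
    _ ≤ _ := by gcongr

/-- indicator that the conditional average is at least `δ` -/
noncomputable def Dg (U : ι → Finset ℕ) (g : (ι → ℕ) → ℝ) (δ : ℝ) (P : Finset ι)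
    (x : ι → ℕ) : ℝ :=
  if δ ≤ cnd U g P x then 1 else 0

lemma Dg_01 (U : ι → Finset ℕ) (g : (ι → ℕ) → ℝ) (δ : ℝ) (P : Finset ι) (x : ι → ℕ) :
    Dg U g δ P x = 0 ∨ Dg U g δ P x = 1 := by
  unfold Dg; split_ifs <;> simp

lemma Dg_nonneg (U : ι → Finset ℕ) (g : (ι → ℕ) → ℝ) (δ : ℝ) (P : Finset ι) (x : ι → ℕ) :
    0 ≤ Dg U g δ P x := by
  rcases Dg_01 U g δ P x with h | h <;> simp [h]

lemma Dg_le_one (U : ι → Finset ℕ) (g : (ι → ℕ) → ℝ) (δ : ℝ) (P : Finset ι) (x : ι → ℕ) :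
    Dg U g δ P x ≤ 1 := by
  rcases Dg_01 U g δ P x with h | h <;> simp [h]

lemma Dg_dep (U : ι → Finset ℕ) (g : (ι → ℕ) → ℝ) (δ : ℝ) (P : Finset ι) :
    Dep (Dg U g δ P) P := by
  intro x y hxy
  unfold Dg
  rw [Dep.cnd U g P x y hxy]

lemma tele {W : ι → Finset ℕ} (hW : ∀ i, (W i).Nonempty) (hne : Nonempty ι) {ε : ℝ}
    {J : Type*} [DecidableEq J] (R : J → (ι → ℕ) → ℝ) (D : J → Finset ι)
    (h01 : ∀ j x, R j x = 0 ∨ R j x = 1)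
    (hD : ∀ j, Dep (R j) (D j)) (hr : ∀ j, Reg W (R j) ∅ ε) (S : Finset J)
    (hS : ∀ j ∈ S, ∀ k ∈ S, j ≠ k → (D j ∩ D k).card ≤ 1) :
    EU W (fun x => ∏ j ∈ S, R j x) ≤ ∏ j ∈ S, EU W (R j) + S.card * ε := by
  induction S using Finset.induction_on with
  | empty => simp [EU_const hW]
  | insert a S ha ih =>
    have ih' := ih (fun j hj k hk => hS j (Finset.mem_insert_of_mem hj) k (Finset.mem_insert_of_mem hk))
    have key := Reg.prod' hW hne (hD a) (Finset.empty_subset _) (hr a) S R D (fun j _ => hD j)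
      (fun j hj => Or.inr ⟨h01 j, hS j (Finset.mem_insert_of_mem hj) a (Finset.mem_insert_self _ _)
        (fun h => ha (h ▸ hj))⟩)
    have e : EU W (fun x => ∏ j ∈ insert a S, R j x)
        = EU W (fun x => (R a x - cnd W (R a) ∅ x) * ∏ j ∈ S, R j x)
          + EU W (R a) * EU W (fun x => ∏ j ∈ S, R j x) := by
      rw [← EU_cmul, ← EU_add]
      congr 1; ext x
      rw [Finset.prod_insert ha, cnd_empty]; ring
    rw [e, Finset.prod_insert ha, Finset.card_insert_of_notMem ha]
    have h0 : 0 ≤ EU W (R a) := EU_nonneg fun x => by rcases h01 a x with h | h <;> simp [h]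
    have h1 : EU W (R a) ≤ 1 := EU_le_one hW fun x => by rcases h01 a x with h | h <;> simp [h]
    have hε : 0 ≤ ε := le_trans (abs_nonneg _) key
    have k1 := (abs_le.1 key).2
    have k2 := mul_le_mul_of_nonneg_left ih' h0
    have k3 : EU W (R a) * (S.card * ε) ≤ S.card * ε := mul_le_of_le_one_left (by positivity) h1
    push_cast
    linarith

lemma edge_bound {U W : ι → Finset ℕ} (hW : ∀ i, (W i).Nonempty) (hWU : ∀ i, W i ⊆ U i)
    (hne : Nonempty ι) {c : ℝ} (hc : 0 < c)
    (hcard : c * ((Fintype.piFinset U).card : ℝ) ≤ ((Fintype.piFinset W).card : ℝ))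
    (g : (ι → ℕ) → ℝ) (e : Finset ι) (hg : Dep g e) (hg01 : ∀ x, g x = 0 ∨ g x = 1)
    {δ ε : ℝ} (hδ : 0 ≤ δ) {J : Type*} [DecidableEq J] (S : Finset J) (P : J → Finset ι)
    (hP : ∀ j ∈ S, P j ⊆ e) (hPP : ∀ j ∈ S, ∀ k ∈ S, j ≠ k → (P j ∩ P k).card ≤ 1)
    (hr : ∀ j, Reg W (Dg U g δ (P j)) ∅ ε) :
    EU W g ≤ ∏ j ∈ S, EU W (Dg U g δ (P j)) + S.card * ε + S.card * (δ / c) := by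
  have hU : ∀ i, (U i).Nonempty := fun i => (hW i).mono (hWU i)
  have hg0 : ∀ x, 0 ≤ g x := fun x => by rcases hg01 x with h | h <;> simp [h]
  have hg1 : ∀ x, g x ≤ 1 := fun x => by rcases hg01 x with h | h <;> simp [h]
  have h1 : EU W g ≤ EU W (fun x => ∏ j ∈ S, Dg U g δ (P j) x)
      + ∑ j ∈ S, EU W (fun x => g x * (1 - Dg U g δ (P j) x)) := by
    rw [← EU_sum, ← EU_add]
    apply EU_mono
    intro x _
    have hnn : ∀ j ∈ S, 0 ≤ g x * (1 - Dg U g δ (P j) x) := fun j _ =>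
      mul_nonneg (hg0 x) (by linarith [Dg_le_one U g δ (P j) x])
    by_cases hall : ∀ j ∈ S, Dg U g δ (P j) x = 1
    · rw [Finset.prod_eq_one hall]
      have := Finset.sum_nonneg hnn
      linarith [hg1 x]
    · push Not at hall
      obtain ⟨j, hj, hj1⟩ := hall
      have hj0 := (Dg_01 U g δ (P j) x).resolve_right hj1
      rw [Finset.prod_eq_zero hj hj0]
      have := Finset.single_le_sum hnn hj
      rw [hj0] at this
      linarith
  have h2 : ∀ j ∈ S, EU W (fun x => g x * (1 - Dg U g δ (P j) x)) ≤ δ / c := by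
    intro j hj
    refine le_trans (EU_subbox hW hWU hc hcard _ (fun x =>
      mul_nonneg (hg0 x) (by linarith [Dg_le_one U g δ (P j) x]))) ?_
    gcongr
    rw [EU_proj hU hg (s := fun x => 1 - Dg U g δ (P j) x) (f := P j)
      (fun x y hxy => by simp only [Dg_dep U g δ (P j) x y hxy]) (Finset.inter_eq_right.2 (hP j hj))]
    conv_rhs => rw [← EU_const hU δ]
    apply EU_mono
    intro x _
    unfold Dg
    split_ifs with h
    · simpa using hδ
    · push Not at h; linarith
  have h3 := tele hW hne (fun j => Dg U g δ (P j)) P (fun j => Dg_01 U g δ (P j))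
    (fun j => Dg_dep U g δ (P j)) hr S hPP
  have h4 := Finset.sum_le_sum h2
  rw [Finset.sum_const, nsmul_eq_mul] at h4
  linarith

lemma pair_bound {U W : ι → Finset ℕ} (hW : ∀ i, (W i).Nonempty) (hWU : ∀ i, W i ⊆ U i)
    {c : ℝ} (hc : 0 < c)
    (hcard : c * ((Fintype.piFinset U).card : ℝ) ≤ ((Fintype.piFinset W).card : ℝ))
    (ge gf : (ι → ℕ) → ℝ) (e f P : Finset ι) (hge : Dep ge e) (hgf : Dep gf f) (hP : e ∩ f = P)
    (he0 : ∀ x, 0 ≤ ge x) (hf0 : ∀ x, 0 ≤ gf x) {δ : ℝ} (hδ : 0 < δ) :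
    EU W (fun x => Dg U ge δ P x * Dg U gf δ P x)
      ≤ EU U (fun x => ge x * gf x) / (δ ^ 2 * c) := by
  have hU : ∀ i, (U i).Nonempty := fun i => (hW i).mono (hWU i)
  refine le_trans (EU_subbox hW hWU hc hcard _ (fun x =>
    mul_nonneg (Dg_nonneg _ _ _ _ x) (Dg_nonneg _ _ _ _ x))) ?_
  rw [← div_div]
  gcongr
  rw [le_div_iff₀ (by positivity)]
  have e1 : EU U (fun x => ge x * gf x) = EU U (fun x => cnd U ge P x * cnd U gf P x) := by
    rw [EU_proj hU hge hgf hP]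
    have := EU_proj hU hgf (s := cnd U ge P) (Dep.cnd U ge P)
      (Finset.inter_eq_right.2 (hP ▸ Finset.inter_subset_right : P ⊆ f))
    simp only [mul_comm (gf _), mul_comm (cnd U gf P _)] at this
    exact this
  rw [e1, mul_comm, ← EU_cmul]
  apply EU_mono
  intro x _
  have a1 : ∀ g : (ι → ℕ) → ℝ, (∀ x, 0 ≤ g x) → δ * Dg U g δ P x ≤ cnd U g P x := by
    intro g hg
    unfold Dg
    split_ifs with h
    · simpa using h
    · simpa using cnd_nonneg hg P x
  calc _ = (δ * Dg U ge δ P x) * (δ * Dg U gf δ P x) := by ring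
    _ ≤ _ := mul_le_mul (a1 ge he0) (a1 gf hf0)
        (mul_nonneg hδ.le (Dg_nonneg _ _ _ _ x)) (cnd_nonneg he0 P x)

lemma sum_le_one_add {W : ι → Finset ℕ} (hW : ∀ i, (W i).Nonempty)
    {J : Type*} [DecidableEq J] (R : J → (ι → ℕ) → ℝ)
    (h01 : ∀ j x, R j x = 0 ∨ R j x = 1) (S : Finset J) {β : ℝ} (hβ : 0 ≤ β)
    (hS : ∀ j ∈ S, ∀ k ∈ S, j ≠ k → EU W (fun x => R j x * R k x) ≤ β) :
    ∑ j ∈ S, EU W (R j) ≤ 1 + S.card ^ 2 * β := by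
  have h0 : ∀ j x, 0 ≤ R j x := fun j x => by rcases h01 j x with h | h <;> simp [h]
  have h1 : ∑ j ∈ S, EU W (R j)
      ≤ 1 + ∑ j ∈ S, ∑ k ∈ S, (if j ≠ k then EU W (fun x => R j x * R k x) else 0) := by
    have e : 1 + ∑ j ∈ S, ∑ k ∈ S, (if j ≠ k then EU W (fun x => R j x * R k x) else 0)
        = EU W (fun x => 1 + ∑ j ∈ S, ∑ k ∈ S, (if j ≠ k then R j x * R k x else 0)) := by
      rw [EU_add, EU_const hW, EU_sum]
      congr 1
      refine Finset.sum_congr rfl fun j _ => ?_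
      rw [EU_sum]
      refine Finset.sum_congr rfl fun k _ => ?_
      split_ifs
      · rfl
      · rw [EU_const hW]
    rw [e, ← EU_sum]
    apply EU_mono
    intro x _
    have hnn : ∀ j ∈ S, ∀ k ∈ S, 0 ≤ (if j ≠ k then R j x * R k x else 0) := by
      intro j _ k _
      split_ifs
      · exact mul_nonneg (h0 j x) (h0 k x)
      · exact le_rfl
    by_cases hall : ∀ j ∈ S, R j x = 0
    · rw [Finset.sum_eq_zero hall]
      have := Finset.sum_nonneg fun j hj => Finset.sum_nonneg (hnn j hj)
      linarith
    · push Not at hall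
      obtain ⟨j, hj, hj0⟩ := hall
      have hj1 := (h01 j x).resolve_left hj0
      have h2 := Finset.single_le_sum (fun j hj => Finset.sum_nonneg (hnn j hj)) hj
      have h3 : ∑ k ∈ S, R k x = 1 + ∑ k ∈ S, (if j ≠ k then R j x * R k x else 0) := by
        rw [← Finset.add_sum_erase S _ hj, ← Finset.add_sum_erase S (fun k => if j ≠ k then _ else _) hj]
        rw [hj1]
        simp only [ne_eq, not_true_eq_false, if_false, zero_add, one_mul]
        congr 1
        refine Finset.sum_congr rfl fun k hk => ?_
        rw [if_pos (Finset.ne_of_mem_erase hk).symm]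
      rw [h3]; linarith
  refine h1.trans ?_
  have h2 : ∑ j ∈ S, ∑ k ∈ S, (if j ≠ k then EU W (fun x => R j x * R k x) else 0)
      ≤ ∑ j ∈ S, ∑ k ∈ S, β := by
    refine Finset.sum_le_sum fun j hj => Finset.sum_le_sum fun k hk => ?_
    split_ifs with h
    · exact hS j hj k hk h
    · exact hβ
  simp only [Finset.sum_const, nsmul_eq_mul] at h2
  nlinarith
end PB

lemma amgm {J : Type*} (S : Finset J) (a : J → ℝ) (ha : ∀ j ∈ S, 0 ≤ a j) (hS : 0 < S.card) :
    ∏ j ∈ S, a j ≤ ((∑ j ∈ S, a j) / S.card) ^ S.card := by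
  have h := Real.geom_mean_le_arith_mean S (fun _ => 1) a (by simp) (by simpa using hS) ha
  simp only [Real.rpow_one, Finset.sum_const, nsmul_eq_mul, mul_one, one_mul] at h
  have hp : 0 ≤ ∏ j ∈ S, a j := Finset.prod_nonneg ha
  calc ∏ j ∈ S, a j = ((∏ j ∈ S, a j) ^ ((S.card : ℝ)⁻¹)) ^ S.card := by
        rw [Real.rpow_inv_natCast_pow hp hS.ne']
    _ ≤ _ := by gcongr

lemma card_pairs (r : ℕ) :
    ((Finset.univ : Finset (Fin r × Fin r)).filter (fun p => p.1 < p.2)).card = r.choose 2 := by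
  rw [Finset.card_filter, Fintype.sum_prod_type_right]
  have : ∀ y : Fin r, ∑ x : Fin r, (if x < y then 1 else 0) = (y : ℕ) := by
    intro y
    rw [← Finset.card_filter]
    have : Finset.univ.filter (fun x : Fin r => x < y) = Finset.Iio y := by ext; simp
    rw [this, Fin.card_Iio]
  simp only [this]
  rw [Fin.sum_univ_eq_sum_range (fun i => i) r, Finset.sum_range_id, Nat.choose_two_right]

lemma pair_inter {α : Type*} [LinearOrder α] {x y x' y' : α} (h : x < y) (h' : x' < y')
    (hne : ¬ (x = x' ∧ y = y')) : (({x, y} : Finset α) ∩ {x', y'}).card ≤ 1 := by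
  by_contra hcon
  push Not at hcon
  apply hne
  have e1 : ({x, y} : Finset α) ∩ {x', y'} = {x, y} :=
    Finset.eq_of_subset_of_card_le Finset.inter_subset_left (Finset.card_le_two.trans hcon)
  have e2 : ({x, y} : Finset α) ⊆ {x', y'} := by rw [← e1]; exact Finset.inter_subset_right
  have m1 : x ∈ ({x', y'} : Finset α) := e2 (by simp)
  have m2 : y ∈ ({x', y'} : Finset α) := e2 (by simp)
  simp only [Finset.mem_insert, Finset.mem_singleton] at m1 m2
  rcases m1 with rfl | rfl <;> rcases m2 with rfl | rfl
  · exact absurd h (lt_irrefl _)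
  · exact ⟨rfl, rfl⟩
  · exact absurd h (lt_asymm h')
  · exact absurd h (lt_irrefl _)

lemma phaseB {r : ℕ} (hr : 2 ≤ r) (H : RGraph r) {N K : ℕ} {U W : Fin N → Finset ℕ}
    (hW : ∀ i, (W i).Nonempty) (hWU : ∀ i, W i ⊆ U i)
    {c : ℝ} (hc : 0 < c)
    (hcard : c * ((Fintype.piFinset U).card : ℝ) ≤ ((Fintype.piFinset W).card : ℝ))
    (g : Fin K → Fin N) (hg : StrictMono g) (hK : 3 * (2 + r * r * r + r) ≤ K)
    {δ ε δ₁ η : ℝ} (hδ : 0 < δ) (hδ₁ : 0 ≤ δ₁) (B : ℕ) (hB : 0 < B)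
    (k : Fin r × Fin r → ℕ)
    (hk : ∀ t : Fin r → Fin K, StrictMono t → ∀ p : Fin r × Fin r,
      ⌊(B : ℝ) * EU W (Dg U (hE H (Finset.univ.image (g ∘ t))) δ {g (t p.1), g (t p.2)})⌋₊ = k p)
    (hreg : ∀ e P, Reg W (Dg U (hE H e) δ P) ∅ ε)
    (hpair : ∀ s s' : Fin r → Fin K, StrictMono s → StrictMono s' → ∀ a b a' b' : Fin r,
      a < b → a' < b' → (a, b) ≠ (a', b') → s a = s' a' → s b = s' b' →
      (∀ c c', s c = s' c' → c = a ∨ c = b) →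
      EU U (fun x => hE H (Finset.univ.image (g ∘ s)) x * hE H (Finset.univ.image (g ∘ s')) x) ≤ δ₁)
    (hη : (r.choose 2 : ℝ) / B + (r.choose 2 : ℝ) ^ 2 * (δ₁ / (δ ^ 2 * c)) ≤ η)
    (t : Fin r → Fin K) (ht : StrictMono t) :
    EU W (hE H (Finset.univ.image (g ∘ t)))
      ≤ piR r * (1 + η) ^ (r.choose 2) + r.choose 2 * ε + r.choose 2 * (δ / c) := by
  classical
  set PP := (Finset.univ : Finset (Fin r × Fin r)).filter (fun p => p.1 < p.2) with hPP
  have hPPc : PP.card = r.choose 2 := card_pairs r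
  have hmpos : 0 < r.choose 2 := Nat.choose_pos hr
  have hB' : (0 : ℝ) < B := by exact_mod_cast hB
  have hmem : ∀ p ∈ PP, p.1 < p.2 := fun p hp => (Finset.mem_filter.1 hp).2
  have hNe : Nonempty (Fin N) := ⟨g (t ⟨0, by omega⟩)⟩
  have h1 := edge_bound hW hWU hNe hc hcard (hE H (Finset.univ.image (g ∘ t))) _
    (hE_dep H _) (hE_01 H _) hδ.le (ε := ε) PP (fun p => {g (t p.1), g (t p.2)})
    (by
      intro p _ v hv
      simp only [Finset.mem_insert, Finset.mem_singleton] at hv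
      rcases hv with rfl | rfl
      · exact Finset.mem_image.2 ⟨p.1, Finset.mem_univ _, rfl⟩
      · exact Finset.mem_image.2 ⟨p.2, Finset.mem_univ _, rfl⟩)
    (by
      intro p hp q hq hpq
      apply pair_inter (hg (ht (hmem p hp))) (hg (ht (hmem q hq)))
      rintro ⟨e1, e2⟩
      exact hpq (Prod.ext (ht.injective (hg.injective e1)) (ht.injective (hg.injective e2))))
    (fun p => hreg _ _)
  rw [hPPc] at h1
  -- the product
  have h2 : ∏ p ∈ PP, EU W (Dg U (hE H (Finset.univ.image (g ∘ t))) δ {g (t p.1), g (t p.2)})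
      ≤ ∏ p ∈ PP, (((k p : ℝ) + 1) / B) := by
    apply Finset.prod_le_prod
    · intro p _; exact EU_nonneg fun x => Dg_nonneg _ _ _ _ x
    · intro p _
      rw [le_div_iff₀ hB', ← hk t ht p, mul_comm]
      exact (Nat.lt_floor_add_one _).le
  have h3 := amgm PP (fun p => ((k p : ℝ) + 1) / B) (fun p _ => by positivity)
    (by rw [hPPc]; exact hmpos)
  rw [hPPc] at h3
  -- special copies
  let T : Fin r × Fin r → Fin r → Fin K := fun p c => ⟨posN r p c, lt_of_lt_of_le (posN_lt r p c) hK⟩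
  have hT : ∀ p ∈ PP, StrictMono (T p) := fun p hp => posN_mono r p (hmem p hp)
  let u : Fin K := ⟨2 + r * r * r + r, by omega⟩
  let v : Fin K := ⟨2 * (2 + r * r * r + r), by omega⟩
  have hTu : ∀ p ∈ PP, T p p.1 = u := fun p hp => Fin.ext (posN_fst r p (hmem p hp))
  have hTv : ∀ p ∈ PP, T p p.2 = v := fun p hp => Fin.ext (posN_snd r p (hmem p hp))
  have hTe : ∀ p q : Fin r × Fin r, p ≠ q → ∀ c c', T p c = T q c' → c = p.1 ∨ c = p.2 :=
    fun p q hpq c c' h => posN_eq r p q hpq c c' (congrArg Fin.val h)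
  have h4 := sum_le_one_add hW (fun p : Fin r × Fin r =>
      Dg U (hE H (Finset.univ.image (g ∘ T p))) δ {g u, g v})
    (fun p x => Dg_01 _ _ _ _ x) PP (β := δ₁ / (δ ^ 2 * c)) (by positivity)
    (by
      intro p hp q hq hpq
      refine le_trans (pair_bound hW hWU hc hcard _ _ _ _ {g u, g v} (hE_dep H _) (hE_dep H _) ?_
        (hE_nonneg H _) (hE_nonneg H _) hδ) ?_
      · ext w
        simp only [Finset.mem_inter, Finset.mem_image, Finset.mem_univ, true_and, Function.comp,
          Finset.mem_insert, Finset.mem_singleton]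
        constructor
        · rintro ⟨⟨c, rfl⟩, ⟨c', hc'⟩⟩
          rcases hTe p q hpq c c' (hg.injective hc'.symm) with rfl | rfl
          · rw [hTu p hp]; simp
          · rw [hTv p hp]; simp
        · rintro (rfl | rfl)
          · exact ⟨⟨p.1, by rw [hTu p hp]⟩, q.1, by rw [hTu q hq]⟩
          · exact ⟨⟨p.2, by rw [hTv p hp]⟩, q.2, by rw [hTv q hq]⟩
      · gcongr
        exact hpair (T p) (T q) (hT p hp) (hT q hq) p.1 p.2 q.1 q.2 (hmem p hp) (hmem q hq) hpq
          ((hTu p hp).trans (hTu q hq).symm) ((hTv p hp).trans (hTv q hq).symm) (hTe p q hpq))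
  rw [hPPc] at h4
  have h5 : ∑ p ∈ PP, ((k p : ℝ) / B) ≤ ∑ p ∈ PP,
      EU W (Dg U (hE H (Finset.univ.image (g ∘ T p))) δ {g u, g v}) := by
    apply Finset.sum_le_sum
    intro p hp
    rw [div_le_iff₀ hB', ← hk (T p) (hT p hp) p, hTu p hp, hTv p hp, mul_comm]
    exact Nat.floor_le (mul_nonneg (EU_nonneg fun x => Dg_nonneg _ _ _ _ x) hB'.le)
  have h6 : ∑ p ∈ PP, (((k p : ℝ) + 1) / B) ≤ 1 + η := by
    have : ∑ p ∈ PP, (((k p : ℝ) + 1) / B) = ∑ p ∈ PP, ((k p : ℝ) / B) + r.choose 2 / B := by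
      simp only [add_div, Finset.sum_add_distrib, Finset.sum_const, hPPc, nsmul_eq_mul]
      ring
    rw [this]; linarith
  have h7 : ((∑ p ∈ PP, (((k p : ℝ) + 1) / B)) / (r.choose 2 : ℝ)) ^ (r.choose 2)
      ≤ piR r * (1 + η) ^ (r.choose 2) := by
    have h0 : 0 ≤ ∑ p ∈ PP, (((k p : ℝ) + 1) / B) := Finset.sum_nonneg fun p _ => by positivity
    calc _ ≤ ((1 + η) / (r.choose 2 : ℝ)) ^ (r.choose 2) := by gcongr
      _ = _ := by unfold piR; rw [div_pow]; field_simp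
  linarith

lemma select_one (X : Finset ℕ) (m : ℕ → ℝ) (s : ℕ) (hs : 0 < s) (hX : s ≤ X.card) :
    ∃ A ⊆ X, A.card = s ∧ (∑ a ∈ A, m a) * X.card ≤ s * ∑ a ∈ X, m a := by
  obtain ⟨n, hn⟩ : ∃ n, X.card = s + n := ⟨X.card - s, by omega⟩
  induction n generalizing X with
  | zero =>
    refine ⟨X, subset_rfl, by omega, ?_⟩
    rw [hn]; simp [mul_comm]
  | succ n ih =>
    have hne : X.Nonempty := by rw [← Finset.card_pos]; omega
    obtain ⟨a, haX, hmax⟩ := Finset.exists_max_image X m hne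
    have hc : (X.erase a).card = s + n := by rw [Finset.card_erase_of_mem haX]; omega
    obtain ⟨A, hA, hAs, hle⟩ := ih (X.erase a) (by omega) hc
    refine ⟨A, hA.trans (Finset.erase_subset _ _), hAs, ?_⟩
    have h1 : ∑ b ∈ X, m b ≤ X.card * m a := by
      have := Finset.sum_le_card_nsmul X m (m a) hmax
      simpa using this
    have h2 : ∑ b ∈ X.erase a, m b = ∑ b ∈ X, m b - m a := by
      rw [← Finset.add_sum_erase X m haX]; ring
    rw [hc, h2] at hle
    rw [hn] at *
    push_cast at *
    have hs' : (1 : ℝ) ≤ s := by exact_mod_cast hs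
    have hn' : (0 : ℝ) ≤ n := by positivity
    have hpos : (0 : ℝ) < s + n := by linarith
    refine le_of_mul_le_mul_right ?_ hpos
    have h3 := mul_le_mul_of_nonneg_right hle (by linarith : (0 : ℝ) ≤ s + (n + 1))
    have h4 := mul_le_mul_of_nonneg_left h1 (by linarith : (0 : ℝ) ≤ s)
    nlinarith

section Sel
variable {ι : Type*} [Fintype ι] [DecidableEq ι]

lemma select_coord (W : ι → Finset ℕ) (hW : ∀ i, (W i).Nonempty) (g : (ι → ℕ) → ℝ) (i : ι)
    (s : ℕ) (hs : 0 < s) (hsW : s ≤ (W i).card) :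
    ∃ A ⊆ W i, A.card = s ∧ EU (Function.update W i A) g ≤ EU W g := by
  classical
  let M : ℕ → ℝ := fun a => ∑ x ∈ (Fintype.piFinset W).filter (fun x => x i = a), g x
  obtain ⟨A, hA, hAs, hle⟩ := select_one (W i) M s hs hsW
  refine ⟨A, hA, hAs, ?_⟩
  have hsum : ∀ A ⊆ W i, ∑ x ∈ Fintype.piFinset (Function.update W i A), g x = ∑ a ∈ A, M a := by
    intro A hA
    rw [← Finset.sum_fiberwise_of_maps_to (t := A) (g := fun x : ι → ℕ => x i)
      (fun x hx => by have := Fintype.mem_piFinset.1 hx i; simpa using this)]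
    refine Finset.sum_congr rfl fun a ha => Finset.sum_congr ?_ fun _ _ => rfl
    ext x
    simp only [Finset.mem_filter, Fintype.mem_piFinset]
    refine and_congr_left fun hxa => forall_congr' fun j => ?_
    by_cases hj : j = i
    · subst hj; simp [hxa, ha, hA ha]
    · simp [hj]
  have hcard : ∀ A : Finset ℕ, ((Fintype.piFinset (Function.update W i A)).card : ℝ)
      = A.card * ∏ j ∈ Finset.univ.erase i, ((W j).card : ℝ) := by
    intro A
    rw [Fintype.card_piFinset, ← Finset.mul_prod_erase _ _ (Finset.mem_univ i)]
    push_cast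
    rw [Function.update_self]
    congr 1
    refine Finset.prod_congr rfl fun j hj => ?_
    rw [Function.update_of_ne (Finset.ne_of_mem_erase hj)]
  have eW : W = Function.update W i (W i) := by simp
  have hprodpos : 0 < ∏ j ∈ Finset.univ.erase i, ((W j).card : ℝ) :=
    Finset.prod_pos fun j _ => by exact_mod_cast Finset.card_pos.2 (hW j)
  have hWi : (0 : ℝ) < (W i).card := by exact_mod_cast Finset.card_pos.2 (hW i)
  have hs' : (0 : ℝ) < s := by exact_mod_cast hs
  conv_rhs => rw [eW]
  unfold EU
  rw [hsum A hA, hsum _ subset_rfl, hcard, hcard, hAs, div_le_div_iff₀ (mul_pos hs' hprodpos) (mul_pos hWi hprodpos)]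
  calc _ = ((∑ a ∈ A, M a) * (W i).card) * ∏ j ∈ Finset.univ.erase i, ((W j).card : ℝ) := by ring
    _ ≤ (s * ∑ a ∈ W i, M a) * ∏ j ∈ Finset.univ.erase i, ((W j).card : ℝ) :=
        mul_le_mul_of_nonneg_right hle hprodpos.le
    _ = _ := by ring

lemma select_all (W : ι → Finset ℕ) (g : (ι → ℕ) → ℝ)
    (s : ℕ) (hs : 0 < s) (hsW : ∀ i, s ≤ (W i).card) :
    ∃ S : ι → Finset ℕ, (∀ i, S i ⊆ W i) ∧ (∀ i, (S i).card = s) ∧ EU S g ≤ EU W g := by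
  classical
  have key : ∀ C : Finset ι, ∃ S : ι → Finset ℕ, (∀ i, S i ⊆ W i) ∧ (∀ i ∈ C, (S i).card = s) ∧
      (∀ i, s ≤ (S i).card) ∧ EU S g ≤ EU W g := by
    intro C
    induction C using Finset.induction_on with
    | empty => exact ⟨W, fun i => subset_rfl, by simp, hsW, le_rfl⟩
    | insert i C hi ih =>
      obtain ⟨S, h1, h2, h3, h4⟩ := ih
      obtain ⟨A, hA, hAs, hle⟩ := select_coord S (fun j => Finset.card_pos.1 (lt_of_lt_of_le hs (h3 j)))
        g i s hs (h3 i)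
      refine ⟨Function.update S i A, ?_, ?_, ?_, hle.trans h4⟩
      · intro j
        by_cases hj : j = i
        · subst hj; simpa using hA.trans (h1 j)
        · simpa [hj] using h1 j
      · intro j hj
        by_cases hji : j = i
        · subst hji; simpa using hAs
        · simpa [hji] using h2 j ((Finset.mem_insert.1 hj).resolve_left hji)
      · intro j
        by_cases hji : j = i
        · subst hji; simpa using hAs.ge
        · simpa [hji] using h3 j
  obtain ⟨S, h1, h2, -, h4⟩ := key Finset.univ
  exact ⟨S, h1, fun i => h2 i (Finset.mem_univ i), h4⟩
end Sel

/-- crossing sets over `e` -/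
def Cr {N : ℕ} (S : Fin N → Finset ℕ) (e : Finset (Fin N)) : Finset (Finset ℕ) :=
  (Fintype.piFinset S).image (fun x => e.image x)

lemma image_eq_iff {N : ℕ} {S : Fin N → Finset ℕ} (hd : ∀ i j, i ≠ j → Disjoint (S i) (S j))
    {x y : Fin N → ℕ} (hx : x ∈ Fintype.piFinset S) (hy : y ∈ Fintype.piFinset S)
    {e f : Finset (Fin N)} (h : e.image x = f.image y) : e = f ∧ ∀ i ∈ e, x i = y i := by
  classical
  rw [Fintype.mem_piFinset] at hx hy
  have aux : ∀ i j, x i = y j → i = j := by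
    intro i j hij
    by_contra hne
    exact Finset.disjoint_left.1 (hd i j hne) (hx i) (hij ▸ hy j)
  have m1 : ∀ i ∈ e, i ∈ f ∧ x i = y i := by
    intro i hi
    have : x i ∈ f.image y := h ▸ Finset.mem_image_of_mem _ hi
    obtain ⟨j, hj, hji⟩ := Finset.mem_image.1 this
    have := aux i j hji.symm
    subst this
    exact ⟨hj, hji.symm⟩
  have m2 : ∀ i ∈ f, i ∈ e := by
    intro i hi
    have : y i ∈ e.image x := h ▸ Finset.mem_image_of_mem _ hi
    obtain ⟨j, hj, hji⟩ := Finset.mem_image.1 this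
    have := aux j i hji
    subst this
    exact hj
  exact ⟨Finset.Subset.antisymm (fun i hi => (m1 i hi).1) m2, fun i hi => (m1 i hi).2⟩

lemma cross_noedge {r N s : ℕ} (H : RGraph r) (S : Fin N → Finset ℕ) (hs : 0 < s)
    (hSc : ∀ i, (S i).card = s) (hd : ∀ i j, i ≠ j → Disjoint (S i) (S j))
    (e : Finset (Fin N)) (he : e.card = r) :
    (((Cr S e).filter (fun A => A ∉ H.edges)).card : ℝ) = (s : ℝ) ^ r * (1 - EU S (hE H e)) := by
  classical
  have hSn : ∀ i, (S i).Nonempty := fun i => Finset.card_pos.1 (by rw [hSc]; exact hs)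
  have hs' : (0 : ℝ) < s := by exact_mod_cast hs
  have hrN : r ≤ N := by rw [← he]; simpa using Finset.card_le_univ e
  have fib : ∀ A ∈ Cr S e, ((Fintype.piFinset S).filter (fun x => e.image x = A)).card
      = s ^ (N - r) := by
    intro A hA
    obtain ⟨x0, hx0, rfl⟩ := Finset.mem_image.1 hA
    have : (Fintype.piFinset S).filter (fun x => e.image x = e.image x0)
        = Fintype.piFinset (fun i => if i ∈ e then {x0 i} else S i) := by
      ext x
      simp only [Finset.mem_filter]
      constructor
      · rintro ⟨h1, h2⟩
        have := (image_eq_iff hd h1 hx0 h2).2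
        rw [Fintype.mem_piFinset] at *
        intro i
        split_ifs with hi
        · simp [this i hi]
        · exact h1 i
      · intro h
        rw [Fintype.mem_piFinset] at h hx0
        have hx : ∀ i ∈ e, x i = x0 i := by
          intro i hi; have := h i; simpa [hi] using this
        refine ⟨?_, Finset.image_congr fun i hi => hx i hi⟩
        rw [Fintype.mem_piFinset]
        intro i
        by_cases hi : i ∈ e
        · rw [hx i hi]; exact hx0 i
        · have := h i; simpa [hi] using this
    rw [this, Fintype.card_piFinset]
    have e2 : ∀ i, (if i ∈ e then ({x0 i} : Finset ℕ) else S i).card = if i ∈ e then 1 else s := by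
      intro i; split_ifs <;> simp [hSc]
    simp only [e2]
    rw [Finset.prod_ite]
    simp only [Finset.prod_const_one, one_mul, Finset.prod_const]
    congr 1
    have : Finset.univ.filter (fun i => i ∉ e) = eᶜ := by ext; simp
    rw [this, Finset.card_compl, he, Fintype.card_fin]
  have h1 : ∑ x ∈ Fintype.piFinset S, (1 - hE H e x)
      = (s : ℝ) ^ (N - r) * (((Cr S e).filter (fun A => A ∉ H.edges)).card : ℝ) := by
    have e1 : ∑ x ∈ Fintype.piFinset S, (1 - hE H e x)
        = ∑ x ∈ Fintype.piFinset S, (fun A : Finset ℕ => if A ∉ H.edges then (1 : ℝ) else 0) (e.image x) := by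
      refine Finset.sum_congr rfl fun x _ => ?_
      unfold hE
      by_cases h : e.image x ∈ H.edges <;> simp [h]
    rw [e1]
    refine (Finset.sum_comp (fun A : Finset ℕ => if A ∉ H.edges then (1 : ℝ) else 0)
      (fun x => e.image x)).trans ?_
    rw [Finset.card_filter]
    push_cast
    rw [Finset.mul_sum]
    refine Finset.sum_congr rfl fun A hA => ?_
    rw [fib A hA]
    simp
  have hcard : ((Fintype.piFinset S).card : ℝ) = (s : ℝ) ^ (N - r) * (s : ℝ) ^ r := by
    rw [Fintype.card_piFinset, ← pow_add, Nat.sub_add_cancel hrN]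
    simp [hSc]
  have h2 : 1 - EU S (hE H e) = (∑ x ∈ Fintype.piFinset S, (1 - hE H e x)) / (Fintype.piFinset S).card := by
    have := EU_sub S (fun _ => 1) (hE H e)
    rw [EU_const hSn] at this
    rw [← this]; rfl
  rw [h2, h1, hcard]
  field_simp

lemma density_contra {r N K s : ℕ} (H : RGraph r) (S : Fin N → Finset ℕ) (hs : 0 < s)
    (hSc : ∀ i, (S i).card = s) (hd : ∀ i j, i ≠ j → Disjoint (S i) (S j))
    (g : Fin K → Fin N) (hg : StrictMono g) (hrK : r ≤ K) (hK : 0 < K) {ρ κ d : ℝ}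
    (hρ0 : 0 ≤ ρ) (hκ : 0 ≤ κ) (hKκ : (r : ℝ) ^ 2 ≤ κ * K)
    (hρ : EU S (fun x => ∑ T ∈ (Finset.univ : Finset (Fin K)).powersetCard r, hE H (T.image g) x)
      ≤ K.choose r * ρ)
    (hdense : d * (((Finset.univ.biUnion (fun j => S (g j))).card).choose r : ℝ)
      ≤ ((H.edges.filter (fun e => e ⊆ Finset.univ.biUnion (fun j => S (g j)))).card : ℝ)) :
    d ≤ ρ + κ := by
  classical
  set SS := Finset.univ.biUnion (fun j => S (g j)) with hSS
  have hs' : (0 : ℝ) < s := by exact_mod_cast hs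
  have hK' : (0 : ℝ) < K := by exact_mod_cast hK
  have hSSc : SS.card = K * s := by
    rw [hSS, Finset.card_biUnion]
    · simp [hSc]
    · intro i _ j _ hij
      exact hd _ _ (hg.injective.ne hij)
  set PS := (Finset.univ : Finset (Fin K)).powersetCard r with hPS
  have hTc : ∀ T ∈ PS, (T.image g).card = r := by
    intro T hT
    rw [Finset.card_image_of_injective _ hg.injective]
    exact (Finset.mem_powersetCard.1 hT).2
  set NE := PS.biUnion (fun T => (Cr S (T.image g)).filter (fun A => A ∉ H.edges)) with hNE
  have hNEc : (NE.card : ℝ) = s ^ r * (K.choose r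
      - EU S (fun x => ∑ T ∈ PS, hE H (T.image g) x)) := by
    rw [hNE, Finset.card_biUnion]
    · push_cast
      rw [Finset.sum_congr rfl (fun T hT => cross_noedge H S hs hSc hd (T.image g) (hTc T hT)),
        ← Finset.mul_sum, Finset.sum_sub_distrib, EU_sum]
      simp [hPS]
    · intro T hT T' hT' hne
      rw [Function.onFun, Finset.disjoint_left]
      intro A hA hA'
      obtain ⟨x, hx, rfl⟩ := Finset.mem_image.1 (Finset.mem_filter.1 hA).1
      obtain ⟨y, hy, hxy⟩ := Finset.mem_image.1 (Finset.mem_filter.1 hA').1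
      have := (image_eq_iff hd hy hx hxy).1
      exact hne (Finset.image_injective hg.injective this).symm
  have hsub : (H.edges.filter (fun e => e ⊆ SS)) ∪ NE ⊆ SS.powersetCard r := by
    intro A hA
    rw [Finset.mem_powersetCard]
    rcases Finset.mem_union.1 hA with h | h
    · rw [Finset.mem_filter] at h
      exact ⟨h.2, H.edges_card A h.1⟩
    · obtain ⟨T, hT, hAT⟩ := Finset.mem_biUnion.1 h
      obtain ⟨x, hx, rfl⟩ := Finset.mem_image.1 (Finset.mem_filter.1 hAT).1
      rw [Fintype.mem_piFinset] at hx
      constructor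
      · intro v hv
        obtain ⟨i, hi, rfl⟩ := Finset.mem_image.1 hv
        obtain ⟨j, hj, rfl⟩ := Finset.mem_image.1 hi
        exact Finset.mem_biUnion.2 ⟨j, Finset.mem_univ _, hx _⟩
      · rw [Finset.card_image_of_injective, hTc T hT]
        intro i j hij
        by_contra hne
        exact Finset.disjoint_left.1 (hd i j hne) (hx i) (hij ▸ hx j)
  have hdisj : Disjoint (H.edges.filter (fun e => e ⊆ SS)) NE := by
    rw [Finset.disjoint_left]
    intro A hA hA'
    obtain ⟨T, hT, hAT⟩ := Finset.mem_biUnion.1 hA'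
    exact (Finset.mem_filter.1 hAT).2 (Finset.mem_filter.1 hA).1
  have hle : ((H.edges.filter (fun e => e ⊆ SS)).card : ℝ) + NE.card ≤ ((K * s).choose r : ℝ) := by
    have := Finset.card_le_card hsub
    rw [Finset.card_union_of_disjoint hdisj, Finset.card_powersetCard, hSSc] at this
    exact_mod_cast this
  rw [hSSc] at hdense
  have hch : 0 < ((K * s).choose r : ℝ) := by
    exact_mod_cast Nat.choose_pos (le_trans hrK (Nat.le_mul_of_pos_right K hs))
  have h1 : (s : ℝ) ^ r * (K.choose r * (1 - ρ)) ≤ (1 - d) * ((K * s).choose r : ℝ) := by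
    have : (s : ℝ) ^ r * (K.choose r * (1 - ρ)) ≤ NE.card := by
      rw [hNEc]; gcongr; linarith
    linarith
  have hd1 : 0 ≤ 1 - d := by
    have : 0 ≤ (1 - d) * ((K * s).choose r : ℝ) := by
      have : (0 : ℝ) ≤ NE.card := by positivity
      linarith
    exact nonneg_of_mul_nonneg_left this hch
  have hf : (0 : ℝ) < (r.factorial : ℝ) := by exact_mod_cast Nat.factorial_pos r
  have h2 : ((K * s).choose r : ℝ) * r.factorial ≤ (K : ℝ) ^ r * (s : ℝ) ^ r := by
    have := Nat.choose_le_pow_div (α := ℝ) r (K * s)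
    rw [le_div_iff₀ hf] at this
    push_cast at this
    rwa [mul_pow] at this
  have h3 : (K : ℝ) ^ r * (1 - κ) ≤ (K.choose r : ℝ) * r.factorial := by
    have a1 : (((K + 1 - r) ^ r : ℕ) : ℝ) ≤ ((K.descFactorial r : ℕ) : ℝ) := by
      exact_mod_cast Nat.pow_sub_le_descFactorial K r
    have a2 : ((K.descFactorial r : ℕ) : ℝ) = (K.choose r : ℝ) * r.factorial := by
      rw [Nat.descFactorial_eq_factorial_mul_choose]; push_cast; ring
    rw [← a2]
    refine le_trans ?_ a1
    push_cast
    have a3 : (K : ℝ) * (1 + -(r / K)) ≤ ((K + 1 - r : ℕ) : ℝ) := by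
      rw [Nat.cast_sub (by omega)]; push_cast
      have : (K : ℝ) * (1 + -(r / K)) = K - r := by field_simp; ring
      rw [this]; linarith
    have a4 : (r : ℝ) / K ≤ 1 := by
      rw [div_le_one hK']; exact_mod_cast hrK
    have a5 := one_add_mul_le_pow (a := -((r : ℝ) / K)) (by linarith) r
    have a6 : (r : ℝ) * ((r : ℝ) / K) ≤ κ := by
      rw [← mul_div_assoc, div_le_iff₀ hK', ← sq]; exact hKκ
    calc (K : ℝ) ^ r * (1 - κ) ≤ (K : ℝ) ^ r * (1 + -((r : ℝ) / K)) ^ r := by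
          gcongr; linarith
      _ = ((K : ℝ) * (1 + -((r : ℝ) / K))) ^ r := by rw [mul_pow]
      _ ≤ _ := by
          apply pow_le_pow_left₀ _ a3
          exact mul_nonneg hK'.le (by linarith)
  by_cases hρ1 : 1 ≤ ρ
  · linarith
  push Not at hρ1
  have hKs : (0 : ℝ) < (K : ℝ) ^ r * (s : ℝ) ^ r := by positivity
  have h4 : ((K : ℝ) ^ r * (s : ℝ) ^ r) * ((1 - κ) * (1 - ρ)) ≤ ((K : ℝ) ^ r * (s : ℝ) ^ r) * (1 - d) := by
    calc _ = ((K : ℝ) ^ r * (1 - κ)) * ((s : ℝ) ^ r * (1 - ρ)) := by ring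
      _ ≤ ((K.choose r : ℝ) * r.factorial) * ((s : ℝ) ^ r * (1 - ρ)) := by
          apply mul_le_mul_of_nonneg_right h3
          exact mul_nonneg (by positivity) (by linarith)
      _ = ((s : ℝ) ^ r * (K.choose r * (1 - ρ))) * r.factorial := by ring
      _ ≤ ((1 - d) * ((K * s).choose r : ℝ)) * r.factorial := by gcongr
      _ = (1 - d) * (((K * s).choose r : ℝ) * r.factorial) := by ring
      _ ≤ (1 - d) * ((K : ℝ) ^ r * (s : ℝ) ^ r) := by gcongr
      _ = _ := by ring
  have h5 := le_of_mul_le_mul_left h4 hKs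
  nlinarith [mul_nonneg hκ hρ0]

lemma letter_finite : Finite Letter := by
  have : Fintype Letter := ⟨{Letter.X, Letter.Y, Letter.Z}, by intro x; cases x <;> simp⟩
  infer_instance

lemma exists_parts (X : Finset ℕ) (N v : ℕ) (h : N * v ≤ X.card) :
    ∃ V : Fin N → Finset ℕ, (∀ i, V i ⊆ X) ∧ (∀ i, (V i).card = v) ∧
      ∀ i j, i ≠ j → Disjoint (V i) (V j) := by
  classical
  let φ : Fin N × Fin v → ℕ := fun p => X.orderEmbOfFin rfl (Fin.castLE h (finProdFinEquiv p))
  have hφ : Function.Injective φ := by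
    intro p q hpq
    exact finProdFinEquiv.injective (Fin.castLE_injective h ((X.orderEmbOfFin rfl).injective hpq))
  refine ⟨fun i => Finset.univ.image (fun j => φ (i, j)), ?_, ?_, ?_⟩
  · intro i x hx
    obtain ⟨j, -, rfl⟩ := Finset.mem_image.1 hx
    exact X.orderEmbOfFin_mem rfl _
  · intro i
    rw [Finset.card_image_of_injective]
    · simp
    · intro j j' hjj
      exact (Prod.mk.inj (hφ hjj)).2
  · intro i j hij
    rw [Finset.disjoint_left]
    intro x hx hx'
    obtain ⟨a, -, rfl⟩ := Finset.mem_image.1 hx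
    obtain ⟨b, -, hb⟩ := Finset.mem_image.1 hx'
    exact hij (Prod.mk.inj (hφ hb)).1.symm

lemma exists_eta (a ε : ℝ) (hε : 0 < ε) (m : ℕ) : ∃ η : ℝ, 0 < η ∧ a * (1 + η) ^ m ≤ a + ε := by
  have hc : Continuous (fun η : ℝ => a * (1 + η) ^ m) := by fun_prop
  have h1 : Filter.Tendsto (fun η : ℝ => a * (1 + η) ^ m) (nhds 0) (nhds a) := by
    have := hc.tendsto 0
    simpa using this
  have h2 : ∀ᶠ η in nhdsWithin (0 : ℝ) (Set.Ioi 0), a * (1 + η) ^ m < a + ε :=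
    (h1.eventually (gt_mem_nhds (by linarith))).filter_mono nhdsWithin_le_nhds
  obtain ⟨η, h, h'⟩ := (h2.and self_mem_nhdsWithin).exists
  exact ⟨η, h', h.le⟩

lemma phaseA_core {r : ℕ} (F : RGraph r) (hql : QuasiLinear F)
    (hadm : ∀ σ, SeqInconsistent r σ → AdmitsSeq F σ) (H : RGraph r) {N K₁ : ℕ}
    (hK₁ : F.verts.card < K₁)
    (hN : ∀ c : (Fin (2 * r - 2) → Fin N) → Set (Fin (2 * r - 2) → Letter),
      ∃ g : Fin K₁ → Fin N, StrictMono g ∧ ∃ col, ∀ t : Fin (2 * r - 2) → Fin K₁,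
        StrictMono t → c (g ∘ t) = col)
    (U : Fin N → Finset ℕ) (hU : ∀ i, (U i).Nonempty) (hUV : ∀ i, U i ⊆ H.verts)
    (hdisj : ∀ i j, i ≠ j → Disjoint (U i) (U j)) {ε δ : ℝ} (hε : 0 ≤ ε) (hδ : 0 ≤ δ)
    (hδ1 : δ ≤ 1) (hεδ : 3 * ε * F.edges.card < δ ^ F.edges.card)
    (hr1 : ∀ e P, Reg U (hE H e) P ε)
    (hr2 : ∀ e f, Reg U (fun x => hE H e x * hE H f x) ∅ ε) :
    IsSubgraph F H ∨ ∃ g : Fin K₁ → Fin N, StrictMono g ∧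
      ∀ s s' : Fin r → Fin K₁, StrictMono s → StrictMono s' → ∀ a b a' b' : Fin r,
      a < b → a' < b' → (a, b) ≠ (a', b') → s a = s' a' → s b = s' b' →
      (∀ c c', s c = s' c' → c = a ∨ c = b) →
      EU U (fun x => hE H (Finset.univ.image (g ∘ s)) x * hE H (Finset.univ.image (g ∘ s')) x)
        ≤ δ := by
  classical
  obtain ⟨g, hg, col, hcol⟩ := hN (fun t => {σ | SeqInconsistent r σ ∧
    δ ≤ EU U (fun x => hE H ((Finset.univ.filter (fun i => σ i ≠ Letter.Y)).image t) x
      * hE H ((Finset.univ.filter (fun i => σ i ≠ Letter.X)).image t) x)})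
  by_cases hc : ∃ σ ∈ col, SeqInconsistent r σ
  · obtain ⟨σ, hσ, hσi⟩ := hc
    left
    refine case_one F hql σ (hadm σ hσi) H U hU hUV hdisj ε δ hε hδ hδ1 hεδ hr1 hr2 g hg hK₁ ?_
    intro t ht
    have := hcol t ht
    rw [← this] at hσ
    exact hσ.2
  · right
    refine ⟨g, hg, ?_⟩
    intro s s' hs hs' a b a' b' hab hab' hne h1 h2 h3
    obtain ⟨σ, hσ, t, ht, e1, e2⟩ := exists_sigma s s' hs hs' hab hab' hne h1 h2 h3
    by_contra hlt
    push Not at hlt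
    apply hc
    refine ⟨σ, ?_, hσ⟩
    rw [← hcol t ht]
    refine ⟨hσ, ?_⟩
    have f1 : (Finset.univ.filter (fun i => σ i ≠ Letter.Y)).image (g ∘ t)
        = Finset.univ.image (g ∘ s) := by
      rw [← Finset.image_image, e1, Finset.image_image]
    have f2 : (Finset.univ.filter (fun i => σ i ≠ Letter.X)).image (g ∘ t)
        = Finset.univ.image (g ∘ s') := by
      rw [← Finset.image_image, e2, Finset.image_image]
    rw [f1, f2]
    exact hlt.le

lemma phaseB_core {r : ℕ} (hr : 2 ≤ r) (H : RGraph r) {N K K₁ : ℕ} {U W : Fin N → Finset ℕ}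
    (hW : ∀ i, (W i).Nonempty) (hWU : ∀ i, W i ⊆ U i)
    {c : ℝ} (hc : 0 < c)
    (hcard : c * ((Fintype.piFinset U).card : ℝ) ≤ ((Fintype.piFinset W).card : ℝ))
    (g₁ : Fin K₁ → Fin N) (hg₁ : StrictMono g₁) (hK : 3 * (2 + r * r * r + r) ≤ K)
    {δ ε δ₁ η : ℝ} (hδ : 0 < δ) (hδ₁ : 0 ≤ δ₁) (B : ℕ) (hB : 0 < B)
    (hram : ∀ c : (Fin r → Fin K₁) → (Fin r × Fin r → Fin (B + 1)),
      ∃ g : Fin K → Fin K₁, StrictMono g ∧ ∃ col, ∀ t : Fin r → Fin K,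
        StrictMono t → c (g ∘ t) = col)
    (hreg : ∀ e P, Reg W (Dg U (hE H e) δ P) ∅ ε)
    (hpair : ∀ s s' : Fin r → Fin K₁, StrictMono s → StrictMono s' → ∀ a b a' b' : Fin r,
      a < b → a' < b' → (a, b) ≠ (a', b') → s a = s' a' → s b = s' b' →
      (∀ c c', s c = s' c' → c = a ∨ c = b) →
      EU U (fun x => hE H (Finset.univ.image (g₁ ∘ s)) x * hE H (Finset.univ.image (g₁ ∘ s')) x)
        ≤ δ₁)
    (hη : (r.choose 2 : ℝ) / B + (r.choose 2 : ℝ) ^ 2 * (δ₁ / (δ ^ 2 * c)) ≤ η) :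
    ∃ g : Fin K → Fin N, StrictMono g ∧
    EU W (fun x => ∑ T ∈ (Finset.univ : Finset (Fin K)).powersetCard r, hE H (T.image g) x)
      ≤ K.choose r * (piR r * (1 + η) ^ (r.choose 2) + r.choose 2 * ε + r.choose 2 * (δ / c)) := by
  classical
  have hbd : ∀ e P, ⌊(B : ℝ) * EU W (Dg U (hE H e) δ P)⌋₊ < B + 1 := by
    intro e P
    have h1 : EU W (Dg U (hE H e) δ P) ≤ 1 := EU_le_one hW fun x => Dg_le_one _ _ _ _ _
    rw [Nat.lt_succ_iff]
    refine Nat.floor_le_of_le ?_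
    have : (0 : ℝ) ≤ B := by positivity
    nlinarith
  obtain ⟨g₂, hg₂, col, hcol⟩ := hram (fun t p =>
    ⟨⌊(B : ℝ) * EU W (Dg U (hE H (Finset.univ.image (g₁ ∘ t))) δ {g₁ (t p.1), g₁ (t p.2)})⌋₊,
      hbd _ _⟩)
  refine ⟨g₁ ∘ g₂, hg₁.comp hg₂, ?_⟩
  have key := phaseB hr H hW hWU hc hcard (g₁ ∘ g₂) (hg₁.comp hg₂) hK hδ hδ₁ B hB
    (fun p => (col p : ℕ)) (ε := ε) (η := η)
    (by
      intro t ht p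
      have := congrArg Fin.val (congrFun (hcol t ht) p)
      exact this)
    hreg
    (by
      intro s s' hs hs' a b a' b' hab hab' hne h1 h2 h3
      exact hpair (g₂ ∘ s) (g₂ ∘ s') (hg₂.comp hs) (hg₂.comp hs') a b a' b' hab hab' hne
        (by simp [h1]) (by simp [h2]) (fun c c' h => h3 c c' (hg₂.injective h)))
    hη
  rw [EU_sum]
  refine (Finset.sum_le_card_nsmul _ _
    (piR r * (1 + η) ^ (r.choose 2) + r.choose 2 * ε + r.choose 2 * (δ / c)) ?_).trans
    (le_of_eq ?_)
  · intro T hT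
    have hTc := (Finset.mem_powersetCard.1 hT).2
    have := key (T.orderEmbOfFin hTc) (T.orderEmbOfFin hTc).strictMono
    have e1 : Finset.univ.image ((g₁ ∘ g₂) ∘ (T.orderEmbOfFin hTc)) = T.image (g₁ ∘ g₂) := by
      rw [← Finset.image_image, Finset.image_orderEmbOfFin_univ]
    rwa [e1] at this
  · rw [Finset.card_powersetCard, Finset.card_univ, Fintype.card_fin, nsmul_eq_mul]

set_option maxHeartbeats 1000000 in
/-- density statement for `C(r,2)^(-C(r,2))`. -/
theorem density_piR (r : ℕ) (hr : 3 ≤ r) (F : RGraph r)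
    (hql : QuasiLinear F) (hinc : ¬ Consistent F)
    (hadm : ∀ σ : Fin (2 * r - 2) → Letter, SeqInconsistent r σ → AdmitsSeq F σ) :
    ∀ ε : ℝ, 0 < ε → ∀ H : ℕ → RGraph r, LocallyDense H (piR r + ε) →
      ∃ n, IsSubgraph F (H n) := by
  classical
  intro ε hε H hH
  have hFL := letter_finite
  obtain ⟨en, hen, hent, hcardt, hdense⟩ := hH
  set m := r.choose 2 with hm
  have hmpos : 0 < m := Nat.choose_pos (by omega)
  have hm' : (0 : ℝ) < m := by exact_mod_cast hmpos
  have hpi0 : 0 < piR r := by unfold piR; positivity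
  -- constants
  obtain ⟨K0, hK0⟩ := exists_nat_ge ((r : ℝ) ^ 2 / (ε / 8))
  obtain ⟨K, hK⟩ : ∃ K, K = K0 + 3 * (2 + r * r * r + r) := ⟨_, rfl⟩
  have hKbig : 3 * (2 + r * r * r + r) ≤ K := by omega
  have hrK : r ≤ K := by
    have : r ≤ 3 * (2 + r * r * r + r) := by
      generalize r * r * r = q; omega
    omega
  have hKpos : 0 < K := by omega
  have hKκ : (r : ℝ) ^ 2 ≤ ε / 8 * K := by
    rw [div_le_iff₀ (by positivity)] at hK0
    have : (K0 : ℝ) ≤ K := by exact_mod_cast (by omega : K0 ≤ K)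
    nlinarith
  obtain ⟨η, hη0, hη⟩ := exists_eta (piR r) (ε / 8) (by positivity) m
  obtain ⟨B0, hB0⟩ := exists_nat_ge ((m : ℝ) / (η / 2))
  obtain ⟨B, hB⟩ : ∃ B, B = B0 + 1 := ⟨_, rfl⟩
  have hBpos : 0 < B := by omega
  have hB' : (0 : ℝ) < B := by exact_mod_cast hBpos
  have hBη : (m : ℝ) / B ≤ η / 2 := by
    rw [div_le_iff₀ (by positivity)] at hB0
    rw [div_le_iff₀ hB']
    have : (B0 : ℝ) ≤ B := by exact_mod_cast (by omega : B0 ≤ B)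
    nlinarith
  obtain ⟨K₁0, hram1⟩ := ramsey r (Fin r × Fin r → Fin (B + 1)) K
  obtain ⟨K₁, hK₁⟩ : ∃ K₁, K₁ = K₁0 + F.verts.card + 1 := ⟨_, rfl⟩
  obtain ⟨N0, hram2⟩ := ramsey (2 * r - 2) (Set (Fin (2 * r - 2) → Letter)) K₁
  obtain ⟨N, hN⟩ : ∃ N, N = N0 + 1 := ⟨_, rfl⟩
  have hNpos : 0 < N := by omega
  have hN' : (0 : ℝ) < N := by exact_mod_cast hNpos
  have hεB : 0 < ε / (8 * m) := by positivity
  obtain ⟨cB, hcB, hcB1, hregB⟩ := exists_regular (Finset (Fin N) × Finset (Fin N)) (Fin N)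
    (ε / (8 * m)) hεB
  obtain ⟨δ, hδ⟩ : ∃ δ : ℝ, δ = ε * cB / (8 * m) := ⟨_, rfl⟩
  have hδ0 : 0 < δ := by rw [hδ]; positivity
  have hδc : (m : ℝ) * (δ / cB) = ε / 8 := by rw [hδ]; field_simp
  obtain ⟨δ₁, hδ₁⟩ : ∃ δ₁ : ℝ, δ₁ = min 1 (η / 2 * (δ ^ 2 * cB) / m ^ 2) := ⟨_, rfl⟩
  have hδ₁0 : 0 < δ₁ := by rw [hδ₁]; exact lt_min one_pos (by positivity)
  have hδ₁1 : δ₁ ≤ 1 := by rw [hδ₁]; exact min_le_left _ _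
  have hδ₁η : (m : ℝ) ^ 2 * (δ₁ / (δ ^ 2 * cB)) ≤ η / 2 := by
    have h1 : δ₁ ≤ η / 2 * (δ ^ 2 * cB) / m ^ 2 := by rw [hδ₁]; exact min_le_right _ _
    rw [le_div_iff₀ (by positivity)] at h1
    rw [← mul_div_assoc, div_le_iff₀ (by positivity)]
    linarith
  obtain ⟨E, hE'⟩ : ∃ E, E = F.edges.card := ⟨_, rfl⟩
  obtain ⟨εA, hεA⟩ : ∃ εA : ℝ, εA = δ₁ ^ E / (3 * (E + 1)) := ⟨_, rfl⟩
  have hεA0 : 0 < εA := by rw [hεA]; positivity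
  have hεAδ : 3 * εA * F.edges.card < δ₁ ^ F.edges.card := by
    rw [← hE']
    have h1 : εA * (3 * (E + 1)) = δ₁ ^ E := by rw [hεA]; field_simp
    rw [← h1]; nlinarith
  obtain ⟨cA, hcA, hcA1, hregA⟩ := exists_regular
    ((Finset (Fin N) × Finset (Fin N)) ⊕ (Finset (Fin N) × Finset (Fin N))) (Fin N) εA hεA0
  -- choice of n
  have ev1 : ∀ᶠ n in Filter.atTop, en n < ε / 4 :=
    hent.eventually (gt_mem_nhds (by positivity))
  have ev2 : ∀ᶠ n in Filter.atTop, en n < cA * cB / (2 * N) :=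
    hent.eventually (gt_mem_nhds (by positivity))
  have ev3 : ∀ᶠ n in Filter.atTop, N ≤ (H n).verts.card := hcardt.eventually_ge_atTop N
  obtain ⟨n, hn1, hn2, hn3⟩ := (ev1.and (ev2.and ev3)).exists
  refine ⟨n, ?_⟩
  -- parts
  obtain ⟨v, hv⟩ : ∃ v, v = (H n).verts.card / N := ⟨_, rfl⟩
  have hv1 : 0 < v := by rw [hv]; exact Nat.div_pos hn3 hNpos
  have hv' : (0 : ℝ) < v := by exact_mod_cast hv1
  have hvN : N * v ≤ (H n).verts.card := by rw [hv]; exact Nat.mul_div_le _ _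
  have hvN2 : ((H n).verts.card : ℝ) ≤ 2 * N * v := by
    have h1 : (H n).verts.card < N * (v + 1) := by
      rw [hv]; exact Nat.lt_mul_div_succ _ hNpos
    have h2 : N * (v + 1) ≤ 2 * N * v := by nlinarith
    exact_mod_cast (h1.le.trans h2)
  obtain ⟨V, hVs, hVc, hVd⟩ := exists_parts (H n).verts N v hvN
  have hVn : ∀ i, (V i).Nonempty := fun i => Finset.card_pos.1 (by rw [hVc]; exact hv1)
  -- phase A
  obtain ⟨U, hUV, hUn, -, hUc, hUr⟩ := hregA V hVn
    (Sum.elim (fun p => hE (H n) p.1) (fun p x => hE (H n) p.1 x * hE (H n) p.2 x))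
    (Sum.elim (fun p => p.2) (fun _ => ∅))
    (by
      rintro (p | p) x
      · exact hE_nonneg _ _ _
      · exact mul_nonneg (hE_nonneg _ _ _) (hE_nonneg _ _ _))
    (by
      rintro (p | p) x
      · exact hE_le_one _ _ _
      · exact mul_le_one₀ (hE_le_one _ _ _) (hE_nonneg _ _ _) (hE_le_one _ _ _))
  have hUd : ∀ i j, i ≠ j → Disjoint (U i) (U j) := fun i j hij =>
    (hVd i j hij).mono (hUV i) (hUV j)
  rcases phaseA_core F hql hadm (H n) (K₁ := K₁) (by omega) (hram2 N (by omega)) U hUn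
    (fun i => (hUV i).trans (hVs i)) hUd hεA0.le hδ₁0.le hδ₁1 hεAδ
    (fun e P => hUr (Sum.inl (e, P))) (fun e f => hUr (Sum.inr (e, f))) with hsub | ⟨g₁, hg₁, hpair⟩
  · exact hsub
  exfalso
  -- phase B
  obtain ⟨W, hWU, hWn, hWp, hWc, hWr⟩ := hregB U hUn
    (fun p => Dg U (hE (H n) p.1) δ p.2) (fun _ => ∅)
    (fun p x => Dg_nonneg _ _ _ _ _) (fun p x => Dg_le_one _ _ _ _ _)
  obtain ⟨g, hg, hgle⟩ := phaseB_core (by omega) (H n) hWn hWU hcB hWp g₁ hg₁ hKbig hδ0 hδ₁0.le B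
    hBpos (hram1 K₁ (by omega)) (fun e P => hWr (e, P)) hpair (η := η)
    (by rw [← hm]; linarith)
  rw [← hm] at hgle
  have hρ : piR r * (1 + η) ^ m + m * (ε / (8 * m)) + m * (δ / cB) ≤ piR r + 3 * ε / 8 := by
    have : (m : ℝ) * (ε / (8 * m)) = ε / 8 := by field_simp
    rw [this, hδc]; linarith
  obtain ⟨s, hs⟩ : ∃ s, s = ⌈cA * cB * v⌉₊ := ⟨_, rfl⟩
  have hspos : 0 < s := by rw [hs]; exact Nat.ceil_pos.2 (by positivity)
  have hsW : ∀ i, s ≤ (W i).card := by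
    intro i
    rw [hs]
    refine Nat.ceil_le.2 ?_
    have h1 := hUc i
    have h2 := hWc i
    rw [hVc] at h1
    calc cA * cB * v = cB * (cA * v) := by ring
      _ ≤ cB * (U i).card := by gcongr
      _ ≤ _ := h2
  obtain ⟨S, hSW, hSc, hSle⟩ := select_all W
    (fun x => ∑ T ∈ (Finset.univ : Finset (Fin K)).powersetCard r, hE (H n) (T.image g) x)
    s hspos hsW
  have hSd : ∀ i j, i ≠ j → Disjoint (S i) (S j) := fun i j hij =>
    (hUd i j hij).mono ((hSW i).trans (hWU i)) ((hSW j).trans (hWU j))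
  have hSSc : (Finset.univ.biUnion (fun j => S (g j))).card = K * s := by
    rw [Finset.card_biUnion]
    · simp [hSc]
    · intro i _ j _ hij
      exact hSd _ _ (hg.injective.ne hij)
  have hSSsub : Finset.univ.biUnion (fun j => S (g j)) ⊆ (H n).verts := by
    intro x hx
    obtain ⟨j, -, hj⟩ := Finset.mem_biUnion.1 hx
    exact hVs _ (hUV _ (hWU _ (hSW _ hj)))
  have hbig : en n * (H n).verts.card ≤ ((Finset.univ.biUnion (fun j => S (g j))).card : ℝ) := by
    rw [hSSc]
    push_cast
    have h1 : cA * cB * v ≤ s := by rw [hs]; exact Nat.le_ceil _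
    have h2 : (1 : ℝ) ≤ K := by exact_mod_cast hKpos
    have h3 : (0 : ℝ) ≤ s := by positivity
    calc en n * (H n).verts.card ≤ cA * cB / (2 * N) * (2 * N * v) := by
          apply mul_le_mul hn2.le hvN2 (by positivity) (by positivity)
      _ = cA * cB * v := by field_simp
      _ ≤ s := h1
      _ ≤ K * s := by nlinarith
  have hfin := density_contra (H n) S hspos hSc hSd g hg hrK hKpos
    (ρ := piR r + 3 * ε / 8) (κ := ε / 8) (d := piR r + ε - en n)
    (by positivity) (by positivity) hKκ
    (hSle.trans (hgle.trans (mul_le_mul_of_nonneg_left hρ (Nat.cast_nonneg _))))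
    (hdense n _ hSSsub hbig)
  linarith

end UTD
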